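/- Let d ≥ 3, λ = (d−2)/2, and let p_λ := 1 + λ/(λ + 2) ≤ p ≤ 2. Then there exists a constant C > 0 such that for every integer n ≥ 1 and every f ∈ L²(S^{d-1}, σ), ‖proj_n f‖_2 ≤ C · n^{λ(1/p − 1/2)} · ‖f‖_p. -/

import Mathlib

open MeasureTheory Metric
open scoped ENNReal

noncomputable section

/-- The unit sphere `S^{d-1}` in `ℝ^d`. -/
abbrev Sph (d : ℕ) := Metric.sphere (0 : EuclideanSpace ℝ (Fin d)) 1

/-- The surface measure `σ` on the unit sphere in `ℝ^d`. -/
def sphMeasure (d : ℕ) : Measure (Sph d) :=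
  (volume : Measure (EuclideanSpace ℝ (Fin d))).toSphere

/-- `Y : S^{d-1} → ℝ` is a spherical harmonic of degree `n` if it is the restriction to
`S^{d-1}` of a polynomial in `d` real variables that is homogeneous of degree `n` and
harmonic (the sum of its second partial derivatives vanishes identically). -/
def IsSphericalHarmonic (d n : ℕ) (Y : Sph d → ℝ) : Prop :=
  ∃ P : MvPolynomial (Fin d) ℝ, P.IsHomogeneous n ∧
    (∑ i : Fin d, MvPolynomial.pderiv i (MvPolynomial.pderiv i P)) = 0 ∧
    ∀ x : Sph d, Y x = MvPolynomial.eval (fun i => (x : EuclideanSpace ℝ (Fin d)) i) P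

/-- `H_k^d`: the subspace of `L²(S^{d-1}, σ)` consisting of (equivalence classes of)
spherical harmonics of degree `k`. -/
def Hspace (d k : ℕ) : Submodule ℝ (Lp ℝ 2 (sphMeasure d)) :=
  Submodule.span ℝ {f : Lp ℝ 2 (sphMeasure d) |
    ∃ Y : Sph d → ℝ, IsSphericalHarmonic d k Y ∧ ⇑f =ᵐ[sphMeasure d] Y}

/-- `T` is the orthogonal projection of `L²(S^{d-1}, σ)` onto `H_k^d`: it maps into
`H_k^d` and `f - T f` is orthogonal to `H_k^d` for every `f`. -/
def IsOrthProjOnto (d k : ℕ)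
    (T : Lp ℝ 2 (sphMeasure d) → Lp ℝ 2 (sphMeasure d)) : Prop :=
  ∀ f : Lp ℝ 2 (sphMeasure d), T f ∈ Hspace d k ∧
    ∀ g ∈ Hspace d k, @inner ℝ _ _ (f - T f) g = 0

/-- The constant `c_n = (Γ(d/2)/(2π^{d/2})) ((d+2n-2)/(d+n-2)) Γ(d+n-1)/(Γ(n+1)Γ(d-1))`. -/
def cCoef (d n : ℕ) : ℝ :=
  Real.Gamma ((d : ℝ) / 2) / (2 * Real.pi ^ ((d : ℝ) / 2)) *
    (((d : ℝ) + 2 * (n : ℝ) - 2) / ((d : ℝ) + (n : ℝ) - 2)) *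
    (Real.Gamma ((d : ℝ) + (n : ℝ) - 1) /
      (Real.Gamma ((n : ℝ) + 1) * Real.Gamma ((d : ℝ) - 1)))

/-- The operator `T_n f = ∑_{j=0}^{d-2} (-1)^j binom(d-2, j) (c_n / c_{n+2j}) proj_{n+2j} f`
on `L²(S^{d-1}, σ)`, built from the orthogonal projections `proj_k` onto `H_k^d`. -/
def Tconv (d : ℕ) (proj : ℕ → Lp ℝ 2 (sphMeasure d) → Lp ℝ 2 (sphMeasure d)) (n : ℕ)
    (f : Lp ℝ 2 (sphMeasure d)) : Lp ℝ 2 (sphMeasure d) :=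
  ∑ j ∈ Finset.range (d - 1),
    ((-1 : ℝ) ^ j * ((d - 2).choose j : ℝ) * (cCoef d n / cCoef d (n + 2 * j))) •
      proj (n + 2 * j) f

/-- The `a`-th moment of the Gaussian weight `exp (-x² / 2)` on the line. -/
def gaussMoment (a : ℕ) : ℝ := ∫ x : ℝ, x ^ a * Real.exp (-x ^ 2 / 2)

lemma integrable_pow_mul_gauss (a : ℕ) :
    Integrable (fun x : ℝ => x ^ a * Real.exp (-x ^ 2 / 2)) := by
  have h := integrable_rpow_mul_exp_neg_mul_sq (b := 1 / 2) (by norm_num) (s := a)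
    (by have : (0 : ℝ) ≤ a := a.cast_nonneg
        linarith)
  refine h.congr (Filter.Eventually.of_forall fun x => ?_)
  simp only [Real.rpow_natCast]
  congr 2
  ring

lemma gaussMoment_succ (a : ℕ) : gaussMoment (a + 1) = a * gaussMoment (a - 1) := by
  have hd : ∀ x : ℝ, HasDerivAt (fun x : ℝ => -Real.exp (-x ^ 2 / 2))
      (x * Real.exp (-x ^ 2 / 2)) x := by
    intro x
    have h1 : HasDerivAt (fun x : ℝ => -x ^ 2 / 2) (-x) x :=
      ((hasDerivAt_pow 2 x).fun_neg.div_const 2).congr_deriv (by norm_num; ring)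
    exact h1.exp.fun_neg.congr_deriv (by ring)
  have h := integral_mul_deriv_eq_deriv_mul_of_integrable
    (u := fun x : ℝ => x ^ a) (u' := fun x => a * x ^ (a - 1))
    (v := fun x : ℝ => -Real.exp (-x ^ 2 / 2)) (v' := fun x => x * Real.exp (-x ^ 2 / 2))
    (fun x _ => by simpa using hasDerivAt_pow a x) (fun x _ => hd x)
    ((integrable_pow_mul_gauss (a + 1)).congr
      (Filter.Eventually.of_forall fun x => by simp only [Pi.mul_apply]; ring))
    (((integrable_pow_mul_gauss (a - 1)).const_mul (-(a : ℝ))).congr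
      (Filter.Eventually.of_forall fun x => by simp only [Pi.mul_apply]; ring))
    ((integrable_pow_mul_gauss a).neg.congr
      (Filter.Eventually.of_forall fun x => by simp only [Pi.mul_apply, Pi.neg_apply]; ring))
  rw [gaussMoment, gaussMoment, ← integral_const_mul]
  calc ∫ x : ℝ, x ^ (a + 1) * Real.exp (-x ^ 2 / 2)
      = ∫ x : ℝ, x ^ a * (x * Real.exp (-x ^ 2 / 2)) := by
        congr 1; ext x; ring
    _ = _ := by
        rw [h, ← integral_neg]
        congr 1; ext x; ring

/-- The Gaussian weight on `ℝ^d`. -/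
def gaussWeight {d : ℕ} (x : Fin d → ℝ) : ℝ := ∏ i, Real.exp (-(x i) ^ 2 / 2)

lemma eval_monomial_mul_gaussWeight {d : ℕ} (a : Fin d →₀ ℕ) (c : ℝ) (x : Fin d → ℝ) :
    MvPolynomial.eval x (MvPolynomial.monomial a c) * gaussWeight x =
      c * ∏ i, ((x i) ^ a i * Real.exp (-(x i) ^ 2 / 2)) := by
  rw [MvPolynomial.eval_monomial, gaussWeight, Finsupp.prod_fintype _ _ (by simp),
    Finset.prod_mul_distrib, mul_assoc]

lemma integrable_eval_mul_gaussWeight {d : ℕ} (P : MvPolynomial (Fin d) ℝ) :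
    Integrable (fun x : Fin d → ℝ => MvPolynomial.eval x P * gaussWeight x) := by
  induction P using MvPolynomial.induction_on' with
  | monomial a c =>
    simp only [eval_monomial_mul_gaussWeight]
    exact (Integrable.fintype_prod (f := fun i x => x ^ a i * Real.exp (-x ^ 2 / 2))
      (fun i => integrable_pow_mul_gauss (a i))).const_mul c
  | add P Q hP hQ =>
    simp only [map_add, add_mul]
    exact hP.add hQ

/-- The integral of a polynomial against the Gaussian weight on `ℝ^d`. -/
def gaussIntegral (d : ℕ) : MvPolynomial (Fin d) ℝ →ₗ[ℝ] ℝ where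
  toFun P := ∫ x : Fin d → ℝ, MvPolynomial.eval x P * gaussWeight x
  map_add' P Q := by
    simp only [map_add, add_mul]
    exact integral_add (integrable_eval_mul_gaussWeight P) (integrable_eval_mul_gaussWeight Q)
  map_smul' c P := by
    simp only [MvPolynomial.smul_eval, mul_assoc, RingHom.id_apply, smul_eq_mul]
    exact integral_const_mul _ _

lemma gaussIntegral_apply {d : ℕ} (P : MvPolynomial (Fin d) ℝ) :
    gaussIntegral d P = ∫ x : Fin d → ℝ, MvPolynomial.eval x P * gaussWeight x := rfl

lemma gaussIntegral_monomial {d : ℕ} (a : Fin d →₀ ℕ) (c : ℝ) :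
    gaussIntegral d (MvPolynomial.monomial a c) = c * ∏ i, gaussMoment (a i) := by
  simp only [gaussIntegral_apply, eval_monomial_mul_gaussWeight]
  rw [integral_const_mul,
    integral_fintype_prod_volume_eq_prod (f := fun i x => x ^ a i * Real.exp (-x ^ 2 / 2))]
  rfl

/-- Gaussian integration by parts. -/
lemma gaussIntegral_X_mul {d : ℕ} (i : Fin d) (P : MvPolynomial (Fin d) ℝ) :
    gaussIntegral d (MvPolynomial.X i * P) = gaussIntegral d (MvPolynomial.pderiv i P) := by
  induction P using MvPolynomial.induction_on' with
  | monomial a c =>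
    rw [MvPolynomial.pderiv_monomial, MvPolynomial.X, MvPolynomial.monomial_mul,
      gaussIntegral_monomial, gaussIntegral_monomial,
      ← Finset.mul_prod_erase _ _ (Finset.mem_univ i),
      ← Finset.mul_prod_erase _ (fun j => gaussMoment ((a - Finsupp.single i 1 : Fin d →₀ ℕ) j))
        (Finset.mem_univ i)]
    have h1 : ∏ j ∈ Finset.univ.erase i, gaussMoment ((Finsupp.single i 1 + a : Fin d →₀ ℕ) j) =
        ∏ j ∈ Finset.univ.erase i, gaussMoment ((a - Finsupp.single i 1 : Fin d →₀ ℕ) j) := by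
      refine Finset.prod_congr rfl fun j hj => ?_
      have : i ≠ j := (Finset.ne_of_mem_erase hj).symm
      simp [this]
    rw [h1]
    have h2 : (Finsupp.single i 1 + a : Fin d →₀ ℕ) i = a i + 1 := by simp [add_comm]
    rw [h2, gaussMoment_succ]
    simp
    ring
  | add P Q hP hQ => simp only [mul_add, map_add, hP, hQ]

lemma gaussIntegral_one_pos (d : ℕ) : 0 < gaussIntegral d 1 := by
  have h0 : 0 < gaussMoment 0 := by
    have := integral_gaussian (1 / 2)
    have h2 : gaussMoment 0 = ∫ x : ℝ, Real.exp (-(1 / 2) * x ^ 2) := by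
      rw [gaussMoment]; congr 1; ext x; rw [pow_zero, one_mul]; congr 1; ring
    rw [h2, this]
    positivity
  rw [show (1 : MvPolynomial (Fin d) ℝ) = MvPolynomial.monomial 0 1 from rfl,
    gaussIntegral_monomial]
  simp only [Finsupp.coe_zero, Pi.zero_apply, one_mul]
  exact Finset.prod_pos fun _ _ => h0

/-- The restriction of a polynomial to the unit sphere. -/
def sphEval {d : ℕ} (P : MvPolynomial (Fin d) ℝ) (x : Sph d) : ℝ :=
  MvPolynomial.eval (fun i => (x : EuclideanSpace ℝ (Fin d)) i) P

lemma eval_smul_of_isHomogeneous {d m : ℕ} {P : MvPolynomial (Fin d) ℝ} (hP : P.IsHomogeneous m)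
    (r : ℝ) (x : Fin d → ℝ) :
    MvPolynomial.eval (fun i => r * x i) P = r ^ m * MvPolynomial.eval x P := by
  rw [MvPolynomial.eval_eq, MvPolynomial.eval_eq, Finset.mul_sum]
  refine Finset.sum_congr rfl fun a ha => ?_
  have h : ∑ i, a i = m := by
    have := hP (MvPolynomial.mem_support_iff.1 ha)
    simpa [Finsupp.weight_apply, Finsupp.sum_fintype] using this
  have h2 : ∏ i ∈ a.support, r ^ a i = r ^ m := by
    rw [Finset.prod_pow_eq_pow_sum, ← h]
    congr 1
    exact Finset.sum_subset (Finset.subset_univ _) (by simp)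
  simp only [mul_pow, Finset.prod_mul_distrib, h2]
  ring

lemma gaussWeight_eq_exp_norm {d : ℕ} (x : EuclideanSpace ℝ (Fin d)) :
    gaussWeight (fun i => x i) = Real.exp (-‖x‖ ^ 2 / 2) := by
  rw [gaussWeight, ← Real.exp_sum, EuclideanSpace.norm_sq_eq]
  congr 1
  simp [← Finset.sum_div]

/-- The radial factor of the Gaussian integral of a polynomial of degree `m` on `ℝ^d`. -/
def radialMoment (d m : ℕ) : ℝ :=
  ∫ r : Set.Ioi (0 : ℝ), (r : ℝ) ^ m * Real.exp (-(r : ℝ) ^ 2 / 2) ∂Measure.volumeIoiPow (d - 1)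

/-- Gaussian integrals in polar coordinates. -/
lemma gaussIntegral_eq_radialMoment_mul {d m : ℕ} (hd : 0 < d) {P : MvPolynomial (Fin d) ℝ}
    (hP : P.IsHomogeneous m) :
    gaussIntegral d P = radialMoment d m * ∫ x, sphEval P x ∂sphMeasure d := by
  have : Nonempty (Fin d) := ⟨⟨0, hd⟩⟩
  let E := EuclideanSpace ℝ (Fin d)
  let F : E → ℝ := fun x => MvPolynomial.eval (fun i => x i) P * gaussWeight (fun i => x i)
  have hdim : Module.finrank ℝ E = d := by simp [E]
  have h1 : gaussIntegral d P = ∫ x : E, F x := by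
    rw [gaussIntegral_apply]
    exact ((EuclideanSpace.volume_preserving_symm_measurableEquiv_toLp (Fin d)).symm.integral_comp
      (MeasurableEquiv.measurableEmbedding _)
      (fun x : E => MvPolynomial.eval (fun i => x i) P * gaussWeight (fun i => x i)))
  have h2 : ∫ x : E, F x =
      ∫ x : ({(0 : E)}ᶜ : Set E), F x ∂((volume : Measure E).comap (Subtype.val)) := by
    rw [integral_subtype_comap (measurableSet_singleton _).compl F,
      restrict_compl_singleton]
  have h3 : ∫ x : ({(0 : E)}ᶜ : Set E), F x ∂((volume : Measure E).comap Subtype.val) =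
      ∫ q : Sph d × Set.Ioi (0 : ℝ), F ((q.2 : ℝ) • (q.1 : E))
        ∂(volume : Measure E).toSphere.prod (.volumeIoiPow (Module.finrank ℝ E - 1)) := by
    rw [← (Measure.measurePreserving_homeomorphUnitSphereProd (volume : Measure E)).integral_comp
      (Homeomorph.measurableEmbedding _)]
    refine integral_congr_ae (Filter.Eventually.of_forall fun x => ?_)
    have hx : ‖(x : E)‖ ≠ 0 := norm_ne_zero_iff.2 x.2
    simp [smul_smul, hx]
  have h4 : ∀ q : Sph d × Set.Ioi (0 : ℝ), F ((q.2 : ℝ) • (q.1 : E)) =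
      sphEval P q.1 * ((q.2 : ℝ) ^ m * Real.exp (-(q.2 : ℝ) ^ 2 / 2)) := by
    intro q
    have hq : ‖(q.2 : ℝ) • (q.1 : E)‖ ^ 2 = (q.2 : ℝ) ^ 2 := by
      simp [norm_smul]
    simp only [F]
    rw [gaussWeight_eq_exp_norm, hq]
    simp only [PiLp.smul_apply, smul_eq_mul]
    rw [eval_smul_of_isHomogeneous hP, sphEval]
    ring
  rw [h1, h2, h3, hdim]
  simp only [h4]
  rw [integral_prod_mul (sphEval P) (fun r : Set.Ioi (0 : ℝ) =>
    (r : ℝ) ^ m * Real.exp (-(r : ℝ) ^ 2 / 2)), mul_comm]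
  rfl

lemma continuous_sphEval {d : ℕ} (P : MvPolynomial (Fin d) ℝ) : Continuous (sphEval P) := by
  unfold sphEval
  exact (MvPolynomial.continuous_eval P).comp (by fun_prop)

instance (d : ℕ) : IsFiniteMeasure (sphMeasure d) := by
  unfold sphMeasure; infer_instance

instance (d : ℕ) : CompactSpace (Sph d) := isCompact_iff_compactSpace.1 (isCompact_sphere _ _)

lemma integrable_of_continuous {d : ℕ} {f : Sph d → ℝ} (hf : Continuous f) :
    Integrable f (sphMeasure d) :=
  hf.integrable_of_hasCompactSupport (HasCompactSupport.of_compactSpace _)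

/-- The Laplacian of a polynomial. -/
def polyLap {d : ℕ} (P : MvPolynomial (Fin d) ℝ) : MvPolynomial (Fin d) ℝ :=
  ∑ i : Fin d, MvPolynomial.pderiv i (MvPolynomial.pderiv i P)

lemma polyLap_pderiv {d : ℕ} (j : Fin d) (P : MvPolynomial (Fin d) ℝ) :
    polyLap (MvPolynomial.pderiv j P) = MvPolynomial.pderiv j (polyLap P) := by
  have hc : ∀ i (Q : MvPolynomial (Fin d) ℝ), MvPolynomial.pderiv i (MvPolynomial.pderiv j Q) =
      MvPolynomial.pderiv j (MvPolynomial.pderiv i Q) := by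
    intro i Q
    have h : ⁅(MvPolynomial.pderiv i : Derivation ℝ (MvPolynomial (Fin d) ℝ)
        (MvPolynomial (Fin d) ℝ)), MvPolynomial.pderiv j⁆ =
        (0 : Derivation ℝ (MvPolynomial (Fin d) ℝ) (MvPolynomial (Fin d) ℝ)) := by
      refine MvPolynomial.derivation_ext fun k => ?_
      classical
      simp only [Derivation.commutator_apply, MvPolynomial.pderiv_X, Pi.single_apply,
        Derivation.zero_apply]
      split_ifs <;> simp
    have := congrArg (fun D => D Q) h
    simpa [Derivation.commutator_apply, sub_eq_zero] using this
  simp only [polyLap, map_sum, hc]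

/-- The linear form `x ↦ ⟨y, x⟩`. -/
def linForm {d : ℕ} (y : Fin d → ℝ) : MvPolynomial (Fin d) ℝ :=
  ∑ i, MvPolynomial.C (y i) * MvPolynomial.X i

/-- The square of the Euclidean norm, as a polynomial. -/
def normSqPoly (d : ℕ) : MvPolynomial (Fin d) ℝ :=
  ∑ i, MvPolynomial.X i * MvPolynomial.X i

lemma pderiv_linForm {d : ℕ} (y : Fin d → ℝ) (i : Fin d) :
    MvPolynomial.pderiv i (linForm y) = MvPolynomial.C (y i) := by
  classical
  simp [linForm, map_sum, MvPolynomial.pderiv_X, Pi.single_apply]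

lemma pderiv_normSqPoly {d : ℕ} (i : Fin d) :
    MvPolynomial.pderiv i (normSqPoly d) = 2 * MvPolynomial.X i := by
  classical
  simp [normSqPoly, map_sum, MvPolynomial.pderiv_X, Pi.single_apply, Derivation.leibniz,
    Finset.sum_add_distrib, two_mul]

lemma isHomogeneous_linForm {d : ℕ} (y : Fin d → ℝ) : (linForm y).IsHomogeneous 1 := by
  refine MvPolynomial.IsHomogeneous.sum _ _ _ fun i _ => ?_
  simpa using (MvPolynomial.isHomogeneous_C _ (y i)).mul (MvPolynomial.isHomogeneous_X ℝ i)

lemma isHomogeneous_normSqPoly (d : ℕ) : (normSqPoly d).IsHomogeneous 2 := by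
  refine MvPolynomial.IsHomogeneous.sum _ _ _ fun i _ => ?_
  simpa using (MvPolynomial.isHomogeneous_X ℝ i).mul (MvPolynomial.isHomogeneous_X ℝ i)

lemma succ_mul_gaussIntegral_mul {d k : ℕ} {Y : MvPolynomial (Fin d) ℝ} (hY : Y.IsHomogeneous k)
    (hL : polyLap Y = 0) (Q : MvPolynomial (Fin d) ℝ) :
    k * gaussIntegral d (Y * Q) =
      ∑ i, gaussIntegral d (MvPolynomial.pderiv i Y * MvPolynomial.pderiv i Q) := by
  have h1 : (k : ℝ) * gaussIntegral d (Y * Q) =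
      ∑ i, gaussIntegral d (MvPolynomial.X i * (MvPolynomial.pderiv i Y * Q)) := by
    rw [← map_sum, ← smul_eq_mul, ← map_smul]
    congr 1
    simp_rw [← mul_assoc]
    rw [← Finset.sum_mul, hY.sum_X_mul_pderiv]
    simp [MvPolynomial.smul_eq_C_mul, mul_assoc]
  rw [h1]
  simp only [gaussIntegral_X_mul, Derivation.leibniz, smul_eq_mul, map_add]
  rw [Finset.sum_add_distrib, ← map_sum (gaussIntegral d) (fun i =>
    Q * MvPolynomial.pderiv i (MvPolynomial.pderiv i Y)), ← Finset.mul_sum]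
  change _ + gaussIntegral d (Q * polyLap Y) = _
  rw [hL]
  simp

/-- Harmonic polynomials are orthogonal to polynomials of lower degree. -/
lemma gaussIntegral_mul_eq_zero {d k j : ℕ} {Y Q : MvPolynomial (Fin d) ℝ}
    (hY : Y.IsHomogeneous k) (hL : polyLap Y = 0) (hQ : Q.IsHomogeneous j) (hj : j < k) :
    gaussIntegral d (Y * Q) = 0 := by
  induction k generalizing j Y Q with
  | zero => omega
  | succ k ih =>
    have h := succ_mul_gaussIntegral_mul hY hL Q
    have h0 : ∀ i, gaussIntegral d (MvPolynomial.pderiv i Y * MvPolynomial.pderiv i Q) = 0 := by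
      intro i
      rcases j with _ | j
      · have : Q = MvPolynomial.C (Q.coeff 0) :=
          MvPolynomial.totalDegree_eq_zero_iff_eq_C.1
            ((MvPolynomial.totalDegree_zero_iff_isHomogeneous _).2 hQ)
        rw [this]
        simp
      · exact ih hY.pderiv (by rw [polyLap_pderiv, hL, map_zero]) hQ.pderiv (by omega)
    simp only [h0, Finset.sum_const_zero] at h
    have : ((k + 1 : ℕ) : ℝ) ≠ 0 := by positivity
    exact (mul_eq_zero.1 h).resolve_left this

lemma gaussIntegral_mul_linForm_pow {d k : ℕ} {Y : MvPolynomial (Fin d) ℝ}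
    (hY : Y.IsHomogeneous k) (hL : polyLap Y = 0) (y : Fin d → ℝ) :
    gaussIntegral d (Y * linForm y ^ k) =
      k.factorial * MvPolynomial.eval y Y * gaussIntegral d 1 := by
  induction k generalizing Y with
  | zero =>
    have : Y = MvPolynomial.C (Y.coeff 0) :=
      MvPolynomial.totalDegree_eq_zero_iff_eq_C.1
        ((MvPolynomial.totalDegree_zero_iff_isHomogeneous _).2 hY)
    rw [this, ← MvPolynomial.smul_eq_C_mul, map_smul]
    simp
  | succ k ih =>
    have h := succ_mul_gaussIntegral_mul hY hL (linForm y ^ (k + 1))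
    have h1 : ∀ i, gaussIntegral d
        (MvPolynomial.pderiv i Y * MvPolynomial.pderiv i (linForm y ^ (k + 1))) =
        ((k + 1 : ℕ) : ℝ) * (k.factorial * (y i * MvPolynomial.eval y (MvPolynomial.pderiv i Y))
          * gaussIntegral d 1) := by
      intro i
      have h2 := ih (Y := MvPolynomial.pderiv i Y) hY.pderiv
        (by rw [polyLap_pderiv, hL, map_zero])
      have h3 : MvPolynomial.pderiv i Y * MvPolynomial.pderiv i (linForm y ^ (k + 1)) =
          (((k + 1 : ℕ) : ℝ) * y i) • (MvPolynomial.pderiv i Y * linForm y ^ k) := by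
        rw [Derivation.leibniz_pow, pderiv_linForm, MvPolynomial.smul_eq_C_mul]
        simp
        ring
      rw [h3, map_smul, h2, smul_eq_mul]
      ring
    simp only [h1] at h
    rw [← Finset.mul_sum, ← Finset.sum_mul, ← Finset.mul_sum] at h
    have h4 : ∑ i, y i * MvPolynomial.eval y (MvPolynomial.pderiv i Y) =
        ((k + 1 : ℕ) : ℝ) * MvPolynomial.eval y Y := by
      have := congrArg (MvPolynomial.eval y) hY.sum_X_mul_pderiv
      simpa using this
    rw [h4] at h
    have : ((k + 1 : ℕ) : ℝ) ≠ 0 := by positivity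
    rw [mul_left_cancel₀ this h, Nat.factorial_succ]
    push_cast
    ring

lemma gaussIntegral_normSqPoly_mul {d m : ℕ} {P : MvPolynomial (Fin d) ℝ}
    (hP : P.IsHomogeneous m) :
    gaussIntegral d (normSqPoly d * P) = (d + m) * gaussIntegral d P := by
  have h1 : ∀ i, gaussIntegral d (MvPolynomial.X i * MvPolynomial.X i * P) =
      gaussIntegral d P + gaussIntegral d (MvPolynomial.X i * MvPolynomial.pderiv i P) := by
    intro i
    rw [mul_assoc, gaussIntegral_X_mul, Derivation.leibniz, map_add]
    simp
    ring
  rw [normSqPoly, Finset.sum_mul, map_sum]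
  simp only [h1]
  rw [Finset.sum_add_distrib, ← map_sum (gaussIntegral d)
    (fun i => MvPolynomial.X i * MvPolynomial.pderiv i P), hP.sum_X_mul_pderiv, map_nsmul]
  simp
  ring

lemma gaussIntegral_normSqPoly_pow (d k : ℕ) :
    gaussIntegral d (normSqPoly d ^ k) = (∏ i ∈ Finset.range k, ((d : ℝ) + 2 * i)) *
      gaussIntegral d 1 := by
  induction k with
  | zero => simp
  | succ k ih =>
    rw [pow_succ', gaussIntegral_normSqPoly_mul ((isHomogeneous_normSqPoly d).pow k), ih,
      Finset.prod_range_succ]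
    push_cast
    ring

lemma sphEval_mul {d : ℕ} (P Q : MvPolynomial (Fin d) ℝ) (x : Sph d) :
    sphEval (P * Q) x = sphEval P x * sphEval Q x := by simp [sphEval]

lemma sphEval_normSqPoly {d : ℕ} (x : Sph d) : sphEval (normSqPoly d) x = 1 := by
  have h : ‖(x : EuclideanSpace ℝ (Fin d))‖ ^ 2 = 1 := by simp
  rw [EuclideanSpace.norm_sq_eq] at h
  rw [← h]
  simp [sphEval, normSqPoly, sq]

lemma sphEval_linForm {d : ℕ} (x y : Sph d) :
    sphEval (linForm fun i => (y : EuclideanSpace ℝ (Fin d)) i) x =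
      inner ℝ (x : EuclideanSpace ℝ (Fin d)) (y : EuclideanSpace ℝ (Fin d)) := by
  simp [sphEval, linForm, PiLp.inner_apply]

lemma radialMoment_two_mul {d : ℕ} (hd : 0 < d) (k : ℕ) :
    radialMoment d (2 * k) * (sphMeasure d).real Set.univ =
      (∏ i ∈ Finset.range k, ((d : ℝ) + 2 * i)) * gaussIntegral d 1 := by
  rw [← gaussIntegral_normSqPoly_pow,
    gaussIntegral_eq_radialMoment_mul hd ((isHomogeneous_normSqPoly d).pow k)]
  have : ∀ x : Sph d, sphEval (normSqPoly d ^ k) x = 1 := by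
    intro x
    have := sphEval_normSqPoly x
    simp only [sphEval, map_pow] at this ⊢
    rw [this, one_pow]
  simp [this]

lemma prod_add_two_mul_pos {d : ℕ} (hd : 0 < d) (k : ℕ) :
    0 < ∏ i ∈ Finset.range k, ((d : ℝ) + 2 * i) :=
  Finset.prod_pos fun i _ => by positivity

lemma sphMeasure_real_univ_pos {d : ℕ} (hd : 0 < d) : 0 < (sphMeasure d).real Set.univ := by
  have h := radialMoment_two_mul hd 0
  simp only [mul_zero, Finset.range_zero, Finset.prod_empty, one_mul] at h
  refine lt_of_le_of_ne measureReal_nonneg fun h0 => ?_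
  rw [← h0, mul_zero] at h
  exact (gaussIntegral_one_pos d).ne h

lemma radialMoment_two_mul_ne_zero {d : ℕ} (hd : 0 < d) (k : ℕ) :
    radialMoment d (2 * k) ≠ 0 := by
  intro h0
  have h := radialMoment_two_mul hd k
  rw [h0, zero_mul] at h
  exact (mul_pos (prod_add_two_mul_pos hd k) (gaussIntegral_one_pos d)).ne h

lemma integral_sphEval_mul_eq_zero {d k j : ℕ} (hd : 0 < d) {Y Q : MvPolynomial (Fin d) ℝ}
    (hY : Y.IsHomogeneous k) (hL : polyLap Y = 0) (hQ : Q.IsHomogeneous j) (hj : j < k)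
    (he : Even (k + j)) :
    ∫ x, sphEval Y x * sphEval Q x ∂sphMeasure d = 0 := by
  have h := gaussIntegral_mul_eq_zero hY hL hQ hj
  rw [gaussIntegral_eq_radialMoment_mul hd (hY.mul hQ)] at h
  obtain ⟨l, hl⟩ := he
  rw [hl, ← two_mul] at h
  simpa [sphEval_mul] using (mul_eq_zero.1 h).resolve_left (radialMoment_two_mul_ne_zero hd l)

lemma integral_sphEval_mul_linForm_pow {d k : ℕ} (hd : 0 < d) {Y : MvPolynomial (Fin d) ℝ}
    (hY : Y.IsHomogeneous k) (hL : polyLap Y = 0) (y : Sph d) :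
    (∏ i ∈ Finset.range k, ((d : ℝ) + 2 * i)) *
      ∫ x, sphEval Y x * inner ℝ (x : EuclideanSpace ℝ (Fin d))
        (y : EuclideanSpace ℝ (Fin d)) ^ k ∂sphMeasure d =
      k.factorial * (sphMeasure d).real Set.univ * sphEval Y y := by
  have h := gaussIntegral_mul_linForm_pow hY hL (fun i => (y : EuclideanSpace ℝ (Fin d)) i)
  have hk := (isHomogeneous_linForm (fun i => (y : EuclideanSpace ℝ (Fin d)) i)).pow k
  rw [gaussIntegral_eq_radialMoment_mul hd (hY.mul hk), one_mul, ← two_mul] at h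
  have h2 : ∀ x : Sph d, sphEval (Y * linForm (fun i => (y : EuclideanSpace ℝ (Fin d)) i) ^ k) x =
      sphEval Y x * inner ℝ (x : EuclideanSpace ℝ (Fin d))
        (y : EuclideanSpace ℝ (Fin d)) ^ k := by
    intro x
    rw [sphEval_mul, ← sphEval_linForm]
    simp [sphEval]
  simp only [h2] at h
  have h3 := radialMoment_two_mul hd k
  set I := ∫ x, sphEval Y x * inner ℝ (x : EuclideanSpace ℝ (Fin d))
        (y : EuclideanSpace ℝ (Fin d)) ^ k ∂sphMeasure d
  have h4 : MvPolynomial.eval (fun i => (y : EuclideanSpace ℝ (Fin d)) i) Y = sphEval Y y := rfl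
  rw [h4] at h
  apply mul_left_cancel₀ (gaussIntegral_one_pos d).ne'
  linear_combination (-I) * h3 + (sphMeasure d).real Set.univ * h

/-- The rising factorial `s (s + 1) ⋯ (s + j - 1)`. -/
def risingFact (s : ℝ) (j : ℕ) : ℝ := ∏ i ∈ Finset.range j, (s + i)

lemma risingFact_succ (s : ℝ) (j : ℕ) : risingFact s (j + 1) = risingFact s j * (s + j) :=
  Finset.prod_range_succ _ _

/-- The coefficient of `t ^ a u ^ (a + 2 m)` in `(1 - 2 t u + u²) ^ (-s)`. -/
def gegenbauerCoef (s : ℝ) (a m : ℕ) : ℝ :=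
  (-1) ^ m * 2 ^ a * risingFact s (a + m) / (a.factorial * m.factorial)

/-- The coefficient of `t ^ a u ^ (a + 2 m)` in `(1 - u²) (1 - 2 t u + u²) ^ (-s)`. -/
def zonalCoef (s : ℝ) (a : ℕ) : ℕ → ℝ
  | 0 => gegenbauerCoef s a 0
  | m + 1 => gegenbauerCoef s a (m + 1) - gegenbauerCoef s a m

lemma gegenbauerCoef_succ_right (s : ℝ) (a m : ℕ) :
    (m + 1) * gegenbauerCoef s a (m + 1) = -(s + a + m) * gegenbauerCoef s a m := by
  simp only [gegenbauerCoef, ← add_assoc, risingFact_succ, Nat.factorial_succ]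
  push_cast
  have := Nat.cast_ne_zero (R := ℝ).2 a.factorial_ne_zero
  have := Nat.cast_ne_zero (R := ℝ).2 m.factorial_ne_zero
  field_simp
  ring

lemma gegenbauerCoef_succ_left (s : ℝ) (a m : ℕ) :
    (a + 1) * gegenbauerCoef s (a + 1) m = 2 * (s + a + m) * gegenbauerCoef s a m := by
  simp only [gegenbauerCoef, show a + 1 + m = a + m + 1 by ring, risingFact_succ,
    Nat.factorial_succ]
  push_cast
  have := Nat.cast_ne_zero (R := ℝ).2 a.factorial_ne_zero
  have := Nat.cast_ne_zero (R := ℝ).2 m.factorial_ne_zero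
  field_simp
  ring

lemma zonalCoef_recurrence (s : ℝ) (a m : ℕ) :
    (a + 2) * (a + 1) * zonalCoef s (a + 2) m +
      4 * (m + 1) * (s + a + m) * zonalCoef s a (m + 1) = 0 := by
  have h1 := gegenbauerCoef_succ_left s a m
  have h2 := gegenbauerCoef_succ_left s (a + 1) m
  have h3 := gegenbauerCoef_succ_right s a m
  push_cast at h2
  rcases m with _ | m
  · simp only [zonalCoef]
    push_cast at *
    linear_combination (a + 1 : ℝ) * h2 + 2 * (s + a + 1) * h1 + 4 * (s + a) * h3
  · simp only [zonalCoef]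
    have h4 := gegenbauerCoef_succ_left s a m
    have h5 := gegenbauerCoef_succ_left s (a + 1) m
    have h6 := gegenbauerCoef_succ_right s a m
    push_cast at *
    linear_combination (a + 1 : ℝ) * h2 + 2 * (s + a + m + 2) * h1 +
      4 * (s + a + (m + 1)) * h3 - (a + 1 : ℝ) * h5 - 2 * (s + a + m + 1) * h4
      - 4 * (s + a + (m + 1)) * h6

lemma polyLap_linForm_pow_mul {d : ℕ} (y : Fin d → ℝ) (hy : ∑ i, y i ^ 2 = 1) (a m : ℕ) :
    polyLap (linForm y ^ a * normSqPoly d ^ m) =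
      ((a * (a - 1 : ℕ) : ℕ) : MvPolynomial (Fin d) ℝ) * (linForm y ^ (a - 2) * normSqPoly d ^ m) +
      ((2 * m * (2 * a + d + 2 * (m - 1)) : ℕ) : MvPolynomial (Fin d) ℝ) *
        (linForm y ^ a * normSqPoly d ^ (m - 1)) := by
  have h : ∀ i, MvPolynomial.pderiv i
      (MvPolynomial.pderiv i (linForm y ^ a * normSqPoly d ^ m)) =
      ((a * (a - 1 : ℕ) : ℕ) : MvPolynomial (Fin d) ℝ) * (linForm y ^ (a - 2) * normSqPoly d ^ m) *
        MvPolynomial.C (y i ^ 2) +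
      4 * (a : MvPolynomial (Fin d) ℝ) * (m : MvPolynomial (Fin d) ℝ) * linForm y ^ (a - 1) *
        normSqPoly d ^ (m - 1) *
        (MvPolynomial.C (y i) * MvPolynomial.X i) +
      2 * (m : MvPolynomial (Fin d) ℝ) * linForm y ^ a * normSqPoly d ^ (m - 1) +
      4 * (m : MvPolynomial (Fin d) ℝ) * ((m - 1 : ℕ) : MvPolynomial (Fin d) ℝ) * linForm y ^ a *
        normSqPoly d ^ (m - 2) *
        (MvPolynomial.X i * MvPolynomial.X i) := by
    intro i
    have hc : ∀ n : ℕ, MvPolynomial.pderiv i (n : MvPolynomial (Fin d) ℝ) = 0 :=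
      fun n => (MvPolynomial.pderiv i).map_natCast n
    have hc2 : MvPolynomial.pderiv i (2 : MvPolynomial (Fin d) ℝ) = 0 := hc 2
    simp only [MvPolynomial.pderiv_mul, MvPolynomial.pderiv_pow, pderiv_linForm,
      pderiv_normSqPoly, map_add, hc, hc2, MvPolynomial.pderiv_C, MvPolynomial.pderiv_X_self,
      Nat.sub_sub, map_pow, Nat.cast_mul]
    ring
  have hN : ∑ i : Fin d, (MvPolynomial.X i * MvPolynomial.X i : MvPolynomial (Fin d) ℝ) =
    normSqPoly d := rfl
  have hl : ∑ i : Fin d, (MvPolynomial.C (y i) * MvPolynomial.X i : MvPolynomial (Fin d) ℝ) =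
    linForm y := rfl
  simp only [polyLap, h, Finset.sum_add_distrib, ← Finset.mul_sum, ← map_sum, hy, hN, hl]
  have ha : (a : MvPolynomial (Fin d) ℝ) * (linForm y ^ (a - 1) * linForm y) =
      a * linForm y ^ a := by
    rcases a with _ | a
    · simp
    · simp [pow_succ]
  have hm : ((m - 1 : ℕ) : MvPolynomial (Fin d) ℝ) * (normSqPoly d ^ (m - 2) * normSqPoly d) =
      (m - 1 : ℕ) * normSqPoly d ^ (m - 1) := by
    rcases m with _ | _ | m
    · simp
    · simp
    · simp [pow_succ]
  simp only [Finset.sum_const, Finset.card_univ, Fintype.card_fin, nsmul_eq_mul, map_one]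
  push_cast
  linear_combination (4 * m * normSqPoly d ^ (m - 1)) * ha + (4 * m * linForm y ^ a) * hm

/-- The (unnormalised) zonal harmonic polynomial of degree `k` with pole `y`. -/
def zonalPoly {d : ℕ} (k : ℕ) (y : Fin d → ℝ) : MvPolynomial (Fin d) ℝ :=
  ∑ m ∈ Finset.range (k / 2 + 1), zonalCoef ((d : ℝ) / 2) (k - 2 * m) m •
    (linForm y ^ (k - 2 * m) * normSqPoly d ^ m)

lemma isHomogeneous_zonalPoly {d : ℕ} (k : ℕ) (y : Fin d → ℝ) :
    (zonalPoly k y).IsHomogeneous k := by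
  refine MvPolynomial.IsHomogeneous.sum _ _ _ fun m hm => ?_
  have hm' : m ≤ k / 2 := by simpa [Nat.lt_succ_iff] using hm
  have := ((isHomogeneous_linForm y).pow (k - 2 * m)).mul ((isHomogeneous_normSqPoly d).pow m)
  rw [show 1 * (k - 2 * m) + 2 * m = k by omega] at this
  rw [MvPolynomial.smul_eq_C_mul]
  simpa using (MvPolynomial.isHomogeneous_C _ (zonalCoef ((d : ℝ) / 2) (k - 2 * m) m)).mul this

lemma polyLap_zonalPoly {d : ℕ} (k : ℕ) (y : Fin d → ℝ) (hy : ∑ i, y i ^ 2 = 1) :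
    polyLap (zonalPoly k y) = 0 := by
  have h1 : polyLap (zonalPoly k y) = ∑ m ∈ Finset.range (k / 2 + 1),
      (zonalCoef ((d : ℝ) / 2) (k - 2 * m) m *
          (((k - 2 * m) * (k - 2 * m - 1 : ℕ) : ℕ) : ℝ)) •
        (linForm y ^ (k - 2 * m - 2) * normSqPoly d ^ m) +
      ∑ m ∈ Finset.range (k / 2 + 1),
      (zonalCoef ((d : ℝ) / 2) (k - 2 * m) m *
          ((2 * m * (2 * (k - 2 * m) + d + 2 * (m - 1)) : ℕ) : ℝ)) •
        (linForm y ^ (k - 2 * m) * normSqPoly d ^ (m - 1)) := by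
    rw [← Finset.sum_add_distrib]
    have : polyLap (zonalPoly k y) = ∑ m ∈ Finset.range (k / 2 + 1),
      zonalCoef ((d : ℝ) / 2) (k - 2 * m) m •
        polyLap (linForm y ^ (k - 2 * m) * normSqPoly d ^ m) := by
      simp only [polyLap, zonalPoly, map_sum, Derivation.map_smul, Finset.smul_sum]
      exact Finset.sum_comm
    rw [this]
    refine Finset.sum_congr rfl fun m _ => ?_
    rw [polyLap_linForm_pow_mul y hy, smul_add]
    simp only [MvPolynomial.smul_eq_C_mul, map_mul, map_natCast, mul_assoc]
  rw [h1, Finset.sum_range_succ, Finset.sum_range_succ']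
  have hlast : (k - 2 * (k / 2)) * (k - 2 * (k / 2) - 1) = 0 := by
    rcases Nat.mod_two_eq_zero_or_one k with h | h
    · rw [show k - 2 * (k / 2) = 0 by omega]
    · rw [show k - 2 * (k / 2) = 1 by omega]
  rw [hlast]
  simp only [Nat.cast_zero, mul_zero, zero_smul, add_zero, zero_mul]
  rw [← Finset.sum_add_distrib]
  refine Finset.sum_eq_zero fun m hm => ?_
  have hm' : m < k / 2 := Finset.mem_range.1 hm
  obtain ⟨a, ha⟩ : ∃ a, k - 2 * m = a + 2 := ⟨k - 2 * m - 2, by omega⟩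
  have ha2 : k - 2 * (m + 1) = a := by omega
  rw [ha, ha2, Nat.add_sub_cancel, Nat.add_sub_cancel, ← add_smul]
  have := zonalCoef_recurrence ((d : ℝ) / 2) a m
  convert zero_smul ℝ _
  rw [show a + 2 - 1 = a + 1 by omega]
  push_cast
  linear_combination this

/-- The zonal kernel of degree `k` on `S^{d-1}` as a function of the inner product. -/
def zonalFn (d k : ℕ) (t : ℝ) : ℝ :=
  ((sphMeasure d).real Set.univ)⁻¹ * ∑ m ∈ Finset.range (k / 2 + 1),
    zonalCoef ((d : ℝ) / 2) (k - 2 * m) m * t ^ (k - 2 * m)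

/-- The zonal kernel of degree `k` on `S^{d-1}`. -/
def zonalKernel {d : ℕ} (k : ℕ) (x y : Sph d) : ℝ :=
  zonalFn d k (inner ℝ (x : EuclideanSpace ℝ (Fin d)) (y : EuclideanSpace ℝ (Fin d)))

lemma continuous_zonalFn (d k : ℕ) : Continuous (zonalFn d k) := by
  unfold zonalFn; fun_prop

lemma continuous_zonalKernel (d k : ℕ) :
    Continuous (fun q : Sph d × Sph d => zonalKernel k q.1 q.2) := by
  unfold zonalKernel
  exact (continuous_zonalFn d k).comp (by fun_prop)

lemma sphEval_zonalPoly {d : ℕ} (k : ℕ) (x y : Sph d) :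
    sphEval (zonalPoly k fun i => (y : EuclideanSpace ℝ (Fin d)) i) x =
      ∑ m ∈ Finset.range (k / 2 + 1), zonalCoef ((d : ℝ) / 2) (k - 2 * m) m *
        inner ℝ (x : EuclideanSpace ℝ (Fin d)) (y : EuclideanSpace ℝ (Fin d)) ^ (k - 2 * m) := by
  have hl := sphEval_linForm x y
  have hN := sphEval_normSqPoly x
  simp only [sphEval, zonalPoly, map_sum, MvPolynomial.smul_eval, map_mul, map_pow] at hl hN ⊢
  rw [hl, hN]
  simp

lemma zonalKernel_eq_sphEval {d : ℕ} (k : ℕ) (x y : Sph d) :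
    zonalKernel k x y = ((sphMeasure d).real Set.univ)⁻¹ *
      sphEval (zonalPoly k fun i => (y : EuclideanSpace ℝ (Fin d)) i) x := by
  rw [sphEval_zonalPoly]; rfl

lemma sum_sq_coord {d : ℕ} (y : Sph d) : ∑ i, (y : EuclideanSpace ℝ (Fin d)) i ^ 2 = 1 := by
  have h : ‖(y : EuclideanSpace ℝ (Fin d))‖ ^ 2 = 1 := by simp
  rw [EuclideanSpace.norm_sq_eq] at h
  simpa using h

lemma isSphericalHarmonic_zonalKernel {d : ℕ} (k : ℕ) (y : Sph d) :
    IsSphericalHarmonic d k (fun x => zonalKernel k x y) := by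
  refine ⟨MvPolynomial.C ((sphMeasure d).real Set.univ)⁻¹ *
    zonalPoly k fun i => (y : EuclideanSpace ℝ (Fin d)) i, ?_, ?_, fun x => ?_⟩
  · simpa using (MvPolynomial.isHomogeneous_C _ _).mul (isHomogeneous_zonalPoly k _)
  · have := polyLap_zonalPoly k (fun i => (y : EuclideanSpace ℝ (Fin d)) i) (sum_sq_coord y)
    simp only [MvPolynomial.pderiv_C_mul, ← Finset.mul_sum]
    change _ * polyLap _ = 0
    rw [this, mul_zero]
  · change zonalKernel k x y = _
    rw [zonalKernel_eq_sphEval]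
    simp [sphEval]

/-- The reproducing property of the zonal kernel. -/
lemma integral_zonalKernel_mul {d k : ℕ} (hd : 0 < d) {Y : Sph d → ℝ}
    (hY : IsSphericalHarmonic d k Y) (y : Sph d) :
    ∫ x, zonalKernel k x y * Y x ∂sphMeasure d = Y y := by
  obtain ⟨P, hP, hL, hYP⟩ := hY
  have hYP' : ∀ x, Y x = sphEval P x := hYP
  have hS := sphMeasure_real_univ_pos hd
  have hpow : ∀ j, Continuous fun x : Sph d => sphEval P x *
      inner ℝ (x : EuclideanSpace ℝ (Fin d)) (y : EuclideanSpace ℝ (Fin d)) ^ j := by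
    intro j
    have := continuous_sphEval P
    fun_prop
  have h0 : ∀ m ∈ Finset.range (k / 2), ∫ x, sphEval P x *
      inner ℝ (x : EuclideanSpace ℝ (Fin d)) (y : EuclideanSpace ℝ (Fin d)) ^ (k - 2 * (m + 1))
        ∂sphMeasure d = 0 := by
    intro m hm
    have hm' : m < k / 2 := Finset.mem_range.1 hm
    have := integral_sphEval_mul_eq_zero hd hP hL
      ((isHomogeneous_linForm (fun i => (y : EuclideanSpace ℝ (Fin d)) i)).pow (k - 2 * (m + 1)))
      (by omega) ⟨k - (m + 1), by omega⟩
    have h2 : ∀ x : Sph d,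
        sphEval (linForm (fun i => (y : EuclideanSpace ℝ (Fin d)) i) ^ (k - 2 * (m + 1))) x =
        inner ℝ (x : EuclideanSpace ℝ (Fin d)) (y : EuclideanSpace ℝ (Fin d)) ^
          (k - 2 * (m + 1)) := by
      intro x
      rw [← sphEval_linForm]
      simp [sphEval]
    simpa only [h2] using this
  have h1 : ∫ x, zonalKernel k x y * Y x ∂sphMeasure d = ((sphMeasure d).real Set.univ)⁻¹ *
      ∑ m ∈ Finset.range (k / 2 + 1), zonalCoef ((d : ℝ) / 2) (k - 2 * m) m *
        ∫ x, sphEval P x * inner ℝ (x : EuclideanSpace ℝ (Fin d))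
          (y : EuclideanSpace ℝ (Fin d)) ^ (k - 2 * m) ∂sphMeasure d := by
    simp only [← integral_const_mul]
    rw [← integral_finsetSum _ fun m _ => (integrable_of_continuous (hpow _)).const_mul _,
      ← integral_const_mul]
    refine integral_congr_ae (Filter.Eventually.of_forall fun x => ?_)
    simp only [zonalKernel, zonalFn, hYP', mul_assoc, Finset.sum_mul]
    congr 1
    exact Finset.sum_congr rfl fun m _ => by ring
  have h2 := integral_sphEval_mul_linForm_pow hd hP hL y
  have h3 : zonalCoef ((d : ℝ) / 2) k 0 * k.factorial =
      ∏ i ∈ Finset.range k, ((d : ℝ) + 2 * i) := by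
    have : (k.factorial : ℝ) ≠ 0 := Nat.cast_ne_zero.2 k.factorial_ne_zero
    simp only [zonalCoef, gegenbauerCoef, risingFact, pow_zero, one_mul, add_zero,
      Nat.factorial_zero, Nat.cast_one, mul_one]
    rw [div_mul_cancel₀ _ this]
    conv_lhs => rw [← Finset.card_range k, ← Finset.prod_const, Finset.card_range,
      ← Finset.prod_mul_distrib]
    exact Finset.prod_congr rfl fun i _ => by ring
  rw [h1, Finset.sum_range_succ', Finset.sum_eq_zero fun m hm => by rw [h0 m hm, mul_zero],
    zero_add, hYP']
  simp only [mul_zero, Nat.sub_zero]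
  rw [← h3] at h2
  have hk : (k.factorial : ℝ) ≠ 0 := Nat.cast_ne_zero.2 k.factorial_ne_zero
  field_simp
  apply mul_left_cancel₀ hk
  linear_combination h2

/-- Spherical harmonics of different degrees of equal parity are orthogonal. -/
lemma integral_mul_eq_zero_of_ne {d k j : ℕ} (hd : 0 < d) {Y W : Sph d → ℝ}
    (hY : IsSphericalHarmonic d k Y) (hW : IsSphericalHarmonic d j W) (hkj : k ≠ j)
    (he : Even (k + j)) : ∫ x, Y x * W x ∂sphMeasure d = 0 := by
  obtain ⟨P, hP, hL, hYP⟩ := hY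
  obtain ⟨Q, hQ, hLQ, hWQ⟩ := hW
  have h1 : ∀ x, Y x = sphEval P x := hYP
  have h2 : ∀ x, W x = sphEval Q x := hWQ
  simp only [h1, h2]
  rcases lt_or_gt_of_ne hkj with h | h
  · simp only [mul_comm (sphEval P _)]
    exact integral_sphEval_mul_eq_zero hd hQ hLQ hP h (by rwa [add_comm])
  · exact integral_sphEval_mul_eq_zero hd hP hL hQ h he

lemma IsSphericalHarmonic.continuous {d k : ℕ} {Y : Sph d → ℝ} (hY : IsSphericalHarmonic d k Y) :
    Continuous Y := by
  obtain ⟨P, -, -, h⟩ := hY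
  have : Y = sphEval P := funext h
  rw [this]
  exact continuous_sphEval P

lemma memLp_of_continuous {d : ℕ} {f : Sph d → ℝ} (hf : Continuous f) (p : ℝ≥0∞) :
    MemLp f p (sphMeasure d) := by
  obtain ⟨C, hC⟩ := (isCompact_range hf).isBounded.exists_norm_le
  exact MemLp.of_bound hf.aestronglyMeasurable C
    (Filter.Eventually.of_forall fun x => hC _ ⟨x, rfl⟩)

lemma exists_isSphericalHarmonic_of_mem_Hspace {d k : ℕ} {g : Lp ℝ 2 (sphMeasure d)}
    (hg : g ∈ Hspace d k) : ∃ Y, IsSphericalHarmonic d k Y ∧ ⇑g =ᵐ[sphMeasure d] Y := by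
  induction hg using Submodule.span_induction with
  | mem f hf => exact hf
  | zero =>
    refine ⟨0, ⟨0, MvPolynomial.isHomogeneous_zero _ _ _, by simp, by simp⟩, ?_⟩
    exact Lp.coeFn_zero _ _ _
  | add f g _ _ hf hg =>
    obtain ⟨Y, ⟨P, h1, h2, h3⟩, hY⟩ := hf
    obtain ⟨W, ⟨Q, h4, h5, h6⟩, hW⟩ := hg
    refine ⟨Y + W, ⟨P + Q, h1.add h4, ?_, fun x => by simp [h3, h6]⟩, ?_⟩
    · simp only [map_add, Finset.sum_add_distrib, h2, h5, add_zero]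
    · exact (Lp.coeFn_add f g).trans (hY.add hW)
  | smul c f _ hf =>
    obtain ⟨Y, ⟨P, h1, h2, h3⟩, hY⟩ := hf
    refine ⟨c • Y, ⟨MvPolynomial.C c * P, ?_, ?_, fun x => by simp [h3]⟩, ?_⟩
    · simpa using (MvPolynomial.isHomogeneous_C _ c).mul h1
    · simp only [MvPolynomial.pderiv_C_mul, ← Finset.mul_sum, h2, mul_zero]
    · exact (Lp.coeFn_smul c f).trans (hY.const_smul c)

lemma inner_eq_zero_of_mem_Hspace {d k j : ℕ} (hd : 0 < d) (hkj : k ≠ j) (he : Even (k + j))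
    {f g : Lp ℝ 2 (sphMeasure d)} (hf : f ∈ Hspace d k) (hg : g ∈ Hspace d j) :
    @inner ℝ _ _ f g = 0 := by
  obtain ⟨Y, hY, hfY⟩ := exists_isSphericalHarmonic_of_mem_Hspace hf
  obtain ⟨W, hW, hgW⟩ := exists_isSphericalHarmonic_of_mem_Hspace hg
  rw [L2.inner_def, ← integral_mul_eq_zero_of_ne hd hY hW hkj he]
  refine integral_congr_ae ?_
  filter_upwards [hfY, hgW] with x h1 h2
  simp [h1, h2, mul_comm]

section Projection

variable {d k : ℕ} {T : Lp ℝ 2 (sphMeasure d) → Lp ℝ 2 (sphMeasure d)}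

lemma IsOrthProjOnto.eq_of_mem (hT : IsOrthProjOnto d k T) {f u : Lp ℝ 2 (sphMeasure d)}
    (hu : u ∈ Hspace d k) (h : ∀ g ∈ Hspace d k, @inner ℝ _ _ (f - u) g = 0) : T f = u := by
  have hm := Submodule.sub_mem _ (hT f).1 hu
  have h1 := (hT f).2 _ hm
  have h2 := h _ hm
  rw [← sub_eq_zero, ← inner_self_eq_zero (𝕜 := ℝ)]
  have : T f - u = (f - u) - (f - T f) := by abel
  nth_rewrite 1 [this]
  rw [inner_sub_left, h1, h2, sub_zero]

lemma IsOrthProjOnto.map_sum_smul (hT : IsOrthProjOnto d k T) {ι : Type*} (s : Finset ι)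
    (c : ι → ℝ) (f : ι → Lp ℝ 2 (sphMeasure d)) :
    T (∑ i ∈ s, c i • f i) = ∑ i ∈ s, c i • T (f i) := by
  refine hT.eq_of_mem (Submodule.sum_mem _ fun i _ => Submodule.smul_mem _ _ (hT _).1)
    fun g hg => ?_
  rw [← Finset.sum_sub_distrib, sum_inner]
  refine Finset.sum_eq_zero fun i _ => ?_
  rw [← smul_sub, inner_smul_left, (hT _).2 g hg, mul_zero]

lemma IsOrthProjOnto.inner_map_map (hT : IsOrthProjOnto d k T) (f g : Lp ℝ 2 (sphMeasure d)) :
    @inner ℝ _ _ (T f) (T g) = @inner ℝ _ _ f (T g) := by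
  have := (hT f).2 _ (hT g).1
  rw [inner_sub_left, sub_eq_zero] at this
  exact this.symm

lemma IsOrthProjOnto.ae_eq_integral (hd : 0 < d) (hT : IsOrthProjOnto d k T)
    (f : Lp ℝ 2 (sphMeasure d)) :
    ⇑(T f) =ᵐ[sphMeasure d] fun y => ∫ x, zonalKernel k x y * f x ∂sphMeasure d := by
  obtain ⟨Y, hY, hfY⟩ := exists_isSphericalHarmonic_of_mem_Hspace (hT f).1
  refine hfY.trans (Filter.Eventually.of_forall fun y => ?_)
  have hZ := isSphericalHarmonic_zonalKernel k y
  have hm := memLp_of_continuous hZ.continuous 2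
  have hin : hm.toLp _ ∈ Hspace d k := Submodule.subset_span ⟨_, hZ, hm.coeFn_toLp⟩
  have h := (hT f).2 _ hin
  rw [inner_sub_left, sub_eq_zero, L2.inner_def, L2.inner_def] at h
  calc Y y = ∫ x, zonalKernel k x y * Y x ∂sphMeasure d := (integral_zonalKernel_mul hd hY y).symm
    _ = ∫ x, inner ℝ (T f x) (hm.toLp _ x) ∂sphMeasure d := by
        refine integral_congr_ae ?_
        filter_upwards [hfY, hm.coeFn_toLp] with x h1 h2
        simp [h1, h2]
    _ = ∫ x, inner ℝ (f x) (hm.toLp _ x) ∂sphMeasure d := h.symm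
    _ = _ := by
        refine integral_congr_ae ?_
        filter_upwards [hm.coeFn_toLp] with x h2
        simp [h2]

/-- The indicator function of a measurable set, as an element of `L²`. -/
def indL2 {d : ℕ} {A : Set (Sph d)} (hA : MeasurableSet A) : Lp ℝ 2 (sphMeasure d) :=
  indicatorConstLp 2 hA (measure_ne_top _ _) 1

lemma IsOrthProjOnto.inner_map_indL2 (hd : 0 < d) (hT : IsOrthProjOnto d k T)
    {A B : Set (Sph d)} (hA : MeasurableSet A) (hB : MeasurableSet B) :
    @inner ℝ _ _ (T (indL2 hB)) (T (indL2 hA)) =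
      ∫ y in B, ∫ x in A, zonalKernel k x y ∂sphMeasure d ∂sphMeasure d := by
  rw [hT.inner_map_map, indL2, L2.inner_indicatorConstLp_one]
  refine integral_congr_ae (ae_restrict_of_ae ?_)
  filter_upwards [hT.ae_eq_integral hd (indL2 hA)] with y hy
  rw [hy, ← integral_indicator hA]
  refine integral_congr_ae ?_
  filter_upwards [indicatorConstLp_coeFn (p := 2) (hs := hA)
    (hμs := measure_ne_top (sphMeasure d) _) (c := (1 : ℝ))] with x hx
  rw [indL2, hx]
  by_cases h : x ∈ A <;> simp [h]

end Projection

/-- Bessel's inequality for spherical harmonics of degrees of a fixed parity. -/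
lemma sum_norm_proj_sq_le {d : ℕ} (hd : 0 < d)
    {proj : ℕ → Lp ℝ 2 (sphMeasure d) → Lp ℝ 2 (sphMeasure d)}
    (hproj : ∀ k, IsOrthProjOnto d k (proj k)) (n : ℕ) (f : Lp ℝ 2 (sphMeasure d)) :
    ∑ j ∈ Finset.range (n / 2 + 1), ‖proj (n - 2 * j) f‖ ^ 2 ≤ ‖f‖ ^ 2 := by
  set s := Finset.range (n / 2 + 1)
  set g := ∑ j ∈ s, proj (n - 2 * j) f
  have h1 : @inner ℝ _ _ f g = ∑ j ∈ s, ‖proj (n - 2 * j) f‖ ^ 2 := by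
    rw [inner_sum]
    refine Finset.sum_congr rfl fun j _ => ?_
    rw [← (hproj _).inner_map_map, real_inner_self_eq_norm_sq]
  have h2 : ‖g‖ ^ 2 = ∑ j ∈ s, ‖proj (n - 2 * j) f‖ ^ 2 := by
    rw [← real_inner_self_eq_norm_sq, sum_inner]
    refine Finset.sum_congr rfl fun j hj => ?_
    rw [inner_sum, Finset.sum_eq_single_of_mem j hj, real_inner_self_eq_norm_sq]
    intro l hl hlj
    have hj' : j < n / 2 + 1 := Finset.mem_range.1 hj
    have hl' : l < n / 2 + 1 := Finset.mem_range.1 hl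
    exact inner_eq_zero_of_mem_Hspace hd (by omega) ⟨n - j - l, by omega⟩ (hproj _ f).1
      (hproj _ f).1
  have h3 := norm_sub_sq_real f g
  have h4 : 0 ≤ ‖f - g‖ ^ 2 := by positivity
  rw [h1, h2] at h3
  linarith

/-- The Taylor series at `0` of a function on `ℂ`. -/
def taylorAtZero (f : ℂ → ℂ) : PowerSeries ℂ :=
  PowerSeries.mk fun n => iteratedDeriv n f 0 / n.factorial

lemma coeff_taylorAtZero (f : ℂ → ℂ) (n : ℕ) :
    PowerSeries.coeff n (taylorAtZero f) = iteratedDeriv n f 0 / n.factorial :=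
  PowerSeries.coeff_mk _ _

lemma taylorAtZero_mul {f g : ℂ → ℂ} (hf : AnalyticAt ℂ f 0) (hg : AnalyticAt ℂ g 0) :
    taylorAtZero (fun u => f u * g u) = taylorAtZero f * taylorAtZero g := by
  ext n
  simp only [coeff_taylorAtZero, PowerSeries.coeff_mul,
    iteratedDeriv_fun_mul hf.contDiffAt hg.contDiffAt,
    Finset.Nat.sum_antidiagonal_eq_sum_range_succ_mk, Finset.sum_div, Nat.succ_eq_add_one]
  refine Finset.sum_congr rfl fun i hi => ?_
  have hi' : i ≤ n := Nat.lt_succ_iff.1 (Finset.mem_range.1 hi)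
  rw [Nat.cast_choose _ hi']
  field_simp [Nat.factorial_ne_zero]

lemma taylorAtZero_deriv (f : ℂ → ℂ) :
    taylorAtZero (deriv f) = PowerSeries.derivative ℂ (taylorAtZero f) := by
  ext n
  rw [PowerSeries.coeff_derivative, coeff_taylorAtZero, coeff_taylorAtZero, iteratedDeriv_succ',
    Nat.factorial_succ]
  have : (n : ℂ) + 1 ≠ 0 := by exact_mod_cast n.succ_ne_zero
  have := Nat.cast_ne_zero (R := ℂ).2 n.factorial_ne_zero
  push_cast
  field_simp

lemma taylorAtZero_congr {f g : ℂ → ℂ} (h : f =ᶠ[nhds 0] g) : taylorAtZero f = taylorAtZero g := by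
  ext n
  rw [coeff_taylorAtZero, coeff_taylorAtZero, h.iteratedDeriv_eq]

lemma taylorAtZero_const_mul (c : ℂ) (f : ℂ → ℂ) :
    taylorAtZero (fun u => c * f u) = PowerSeries.C c * taylorAtZero f := by
  ext n
  rw [coeff_taylorAtZero, PowerSeries.coeff_C_mul, coeff_taylorAtZero,
    iteratedDeriv_const_mul_field, mul_div_assoc]

lemma taylorAtZero_one_sub_mul (a : ℂ) :
    taylorAtZero (fun u => 1 - a * u) = 1 - PowerSeries.C a * PowerSeries.X := by
  have hd : deriv (fun u : ℂ => 1 - a * u) = fun _ => -a := by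
    ext u
    have h : HasDerivAt (fun u : ℂ => 1 - a * u) (-(a * 1)) u :=
      ((hasDerivAt_id u).const_mul a).const_sub 1
    rw [h.deriv, mul_one]
  ext n
  rw [coeff_taylorAtZero]
  rcases n with _ | _ | n
  · simp
  · rw [iteratedDeriv_succ', hd]
    simp [PowerSeries.coeff_one]
  · rw [iteratedDeriv_succ', hd, iteratedDeriv_const]
    simp [PowerSeries.coeff_one]

/-- The function `(1 - a u) ^ w`. -/
def oneSubPow (a w u : ℂ) : ℂ := (1 - a * u) ^ w

lemma re_one_sub_mul_pos {a u : ℂ} (ha : ‖a‖ = 1) (hu : ‖u‖ < 1) : 0 < (1 - a * u).re := by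
  have h := (Complex.re_le_norm (a * u)).trans_lt (by rw [norm_mul, ha, one_mul]; exact hu)
  simpa using h

lemma hasDerivAt_oneSubPow {a u : ℂ} (ha : ‖a‖ = 1) (w : ℂ) (hu : ‖u‖ < 1) :
    HasDerivAt (oneSubPow a w) (-(w * a) * (1 - a * u) ^ (w - 1)) u := by
  have h := re_one_sub_mul_pos ha hu
  have h1 : HasDerivAt (fun u : ℂ => 1 - a * u) (-(a * 1)) u :=
    ((hasDerivAt_id u).const_mul a).const_sub 1
  exact (h1.cpow_const (c := w) (Or.inl h)).congr_deriv (by ring)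

lemma differentiableOn_oneSubPow {a : ℂ} (ha : ‖a‖ = 1) (w : ℂ) :
    DifferentiableOn ℂ (oneSubPow a w) (ball 0 1) := fun u hu =>
  (hasDerivAt_oneSubPow ha w (by simpa using hu)).differentiableAt.differentiableWithinAt

lemma analyticAt_oneSubPow {a : ℂ} (ha : ‖a‖ = 1) (w : ℂ) : AnalyticAt ℂ (oneSubPow a w) 0 :=
  (differentiableOn_oneSubPow ha w).analyticAt (ball_mem_nhds _ one_pos)

lemma oneSubPow_eq_mul {a u : ℂ} (ha : ‖a‖ = 1) (w : ℂ) (hu : ‖u‖ < 1) :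
    oneSubPow a w u = (1 - a * u) * oneSubPow a (w - 1) u := by
  have h : 1 - a * u ≠ 0 := fun h0 => by
    have := re_one_sub_mul_pos ha hu
    rw [h0] at this
    simp at this
  rw [oneSubPow, oneSubPow, Complex.cpow_sub _ _ h, Complex.cpow_one]
  field_simp

lemma taylorAtZero_oneSubPow_eq_mul {a : ℂ} (ha : ‖a‖ = 1) (w : ℂ) :
    taylorAtZero (oneSubPow a w) = (1 - PowerSeries.C a * PowerSeries.X) *
      taylorAtZero (oneSubPow a (w - 1)) := by
  rw [← taylorAtZero_one_sub_mul, ← taylorAtZero_mul (by fun_prop) (analyticAt_oneSubPow ha _)]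
  refine taylorAtZero_congr ?_
  filter_upwards [ball_mem_nhds (0 : ℂ) one_pos] with u hu
  exact oneSubPow_eq_mul ha w (by simpa using hu)

lemma derivative_taylorAtZero_oneSubPow {a : ℂ} (ha : ‖a‖ = 1) (w : ℂ) :
    (1 - PowerSeries.C a * PowerSeries.X) *
      PowerSeries.derivative ℂ (taylorAtZero (oneSubPow a w)) =
      PowerSeries.C (-(w * a)) * taylorAtZero (oneSubPow a w) := by
  have h : taylorAtZero (deriv (oneSubPow a w)) =
      taylorAtZero (fun u => -(w * a) * oneSubPow a (w - 1) u) := by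
    refine taylorAtZero_congr ?_
    filter_upwards [ball_mem_nhds (0 : ℂ) one_pos] with u hu
    exact (hasDerivAt_oneSubPow ha w (by simpa using hu)).deriv
  rw [← taylorAtZero_deriv, h, taylorAtZero_const_mul, taylorAtZero_oneSubPow_eq_mul ha w]
  ring

lemma constantCoeff_taylorAtZero_oneSubPow (a w : ℂ) :
    PowerSeries.coeff 0 (taylorAtZero (oneSubPow a w)) = 1 := by
  simp [coeff_taylorAtZero, oneSubPow]

/-- The Taylor coefficients of a function are bounded by its means on circles. -/
lemma norm_coeff_taylorAtZero_le {f : ℂ → ℂ} (hf : DifferentiableOn ℂ f (ball 0 1)) {r : ℝ}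
    (hr0 : 0 < r) (hr1 : r < 1) (n : ℕ) :
    ‖PowerSeries.coeff n (taylorAtZero f)‖ ≤
      ((2 * Real.pi)⁻¹ * ∫ θ : ℝ in 0..2 * Real.pi, ‖f (circleMap 0 r θ)‖) * r⁻¹ ^ n := by
  have hc : DiffContOnCl ℂ f (ball 0 r) :=
    (hf.mono (closedBall_subset_ball hr1)).diffContOnCl_ball subset_rfl
  lift r to NNReal using hr0.le
  have hp := hc.hasFPowerSeriesOnBall (by exact_mod_cast hr0)
  have h := hp.factorial_smul 1 n
  rw [iteratedFDeriv_apply_eq_iteratedDeriv_mul_prod, Finset.prod_const_one, one_smul] at h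
  have hn := norm_cauchyPowerSeries_le f 0 r n
  rw [abs_of_pos hr0] at hn
  refine le_trans ?_ hn
  rw [coeff_taylorAtZero, ← h, nsmul_eq_mul,
    mul_div_cancel_left₀ _ (Nat.cast_ne_zero.2 n.factorial_ne_zero)]
  refine (ContinuousMultilinearMap.le_opNorm _ _).trans ?_
  simp

/-- The Gegenbauer polynomial of degree `n`: the `n`-th Taylor coefficient of
`(1 - 2 t u + u²) ^ (-s)` in `u`. -/
def gegenbauer (s t : ℝ) (n : ℕ) : ℝ :=
  ∑ m ∈ Finset.range (n / 2 + 1), gegenbauerCoef s (n - 2 * m) m * t ^ (n - 2 * m)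

lemma gegenbauerCoef_recurrence {s : ℝ} (hs : 0 < s) (a m : ℕ) :
    (a + 1 + 2 * m + 2) * gegenbauerCoef s (a + 1) (m + 1) =
      2 * (a + 1 + 2 * m + 1 + s) * gegenbauerCoef s a (m + 1) -
        (a + 1 + 2 * m + 2 * s) * gegenbauerCoef s (a + 1) m := by
  have h1 := gegenbauerCoef_succ_left s a (m + 1)
  have h2 := gegenbauerCoef_succ_right s (a + 1) m
  have h : s + a + m + 1 ≠ 0 := by positivity
  push_cast at h1 h2
  apply mul_left_cancel₀ h
  linear_combination (a + 1 + 2 * m + 1 + s : ℝ) * h1 + (a + 1 + 2 * m + 2 * s : ℝ) * h2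

lemma gegenbauer_eq_sum_of_lt (s t : ℝ) {n N : ℕ} (hN : n / 2 < N) :
    gegenbauer s t n = ∑ m ∈ Finset.range N,
      if 2 * m ≤ n then gegenbauerCoef s (n - 2 * m) m * t ^ (n - 2 * m) else 0 := by
  rw [← Finset.sum_filter, gegenbauer]
  refine Finset.sum_congr ?_ fun _ _ => rfl
  ext m
  simp only [Finset.mem_range, Finset.mem_filter]
  omega

lemma gegenbauer_recurrence {s : ℝ} (hs : 0 < s) (t : ℝ) (n : ℕ) :
    (n + 2) * gegenbauer s t (n + 2) =
      2 * t * (n + 1 + s) * gegenbauer s t (n + 1) - (n + 2 * s) * gegenbauer s t n := by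
  rw [gegenbauer_eq_sum_of_lt s t (n := n + 2) (N := n + 3) (by omega),
    gegenbauer_eq_sum_of_lt s t (n := n + 1) (N := n + 3) (by omega),
    gegenbauer_eq_sum_of_lt s t (n := n) (N := n + 2) (by omega),
    Finset.sum_range_succ', Finset.sum_range_succ' (n := n + 2), mul_add, mul_add,
    Finset.mul_sum, Finset.mul_sum, Finset.mul_sum, add_sub_right_comm, ← Finset.sum_sub_distrib]
  congr 1
  · refine Finset.sum_congr rfl fun m _ => ?_
    rcases lt_trichotomy (2 * m) n with h | h | h
    · obtain ⟨a, rfl⟩ : ∃ a, n = a + 1 + 2 * m := ⟨n - 2 * m - 1, by omega⟩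
      rw [if_pos (by omega), if_pos (by omega), if_pos (by omega),
        show a + 1 + 2 * m + 2 - 2 * (m + 1) = a + 1 by omega,
        show a + 1 + 2 * m + 1 - 2 * (m + 1) = a by omega, Nat.add_sub_cancel]
      have := gegenbauerCoef_recurrence hs a m
      push_cast
      linear_combination t ^ (a + 1) * this
    · subst h
      rw [if_pos (by omega), if_neg (by omega), if_pos (by omega),
        show 2 * m + 2 - 2 * (m + 1) = 0 by omega, Nat.sub_self]
      have := gegenbauerCoef_succ_right s 0 m
      push_cast at this ⊢
      linear_combination 2 * this
    · rw [if_neg (by omega), if_neg (by omega), if_neg (by omega)]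
      simp
  · simp only [mul_zero, Nat.zero_le, if_true, Nat.sub_zero]
    have := gegenbauerCoef_succ_left s (n + 1) 0
    push_cast at this
    linear_combination t ^ (n + 2) * this

lemma coeff_mul_oneSubPow_recurrence {a b : ℂ} (ha : ‖a‖ = 1) (hb : ‖b‖ = 1) (w : ℂ) :
    PowerSeries.coeff 1 (taylorAtZero (oneSubPow a w) * taylorAtZero (oneSubPow b w)) =
      -w * (a + b) ∧ ∀ n : ℕ,
    (n + 2) * PowerSeries.coeff (n + 2)
        (taylorAtZero (oneSubPow a w) * taylorAtZero (oneSubPow b w)) =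
      (a + b) * (n + 1 - w) * PowerSeries.coeff (n + 1)
        (taylorAtZero (oneSubPow a w) * taylorAtZero (oneSubPow b w)) -
      a * b * (n - 2 * w) * PowerSeries.coeff n
        (taylorAtZero (oneSubPow a w) * taylorAtZero (oneSubPow b w)) := by
  have h1 := derivative_taylorAtZero_oneSubPow ha w
  have h2 := derivative_taylorAtZero_oneSubPow hb w
  have hA := constantCoeff_taylorAtZero_oneSubPow a w
  have hB := constantCoeff_taylorAtZero_oneSubPow b w
  set A := taylorAtZero (oneSubPow a w)
  set B := taylorAtZero (oneSubPow b w)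
  have h0 : PowerSeries.coeff 0 (A * B) = 1 := by
    rw [PowerSeries.coeff_mul]
    simp [hA, hB]
  have h3 : PowerSeries.derivative ℂ (A * B) + PowerSeries.X * (PowerSeries.C (-(a + b)) *
      PowerSeries.derivative ℂ (A * B) +
      PowerSeries.C (a * b) * (PowerSeries.X * PowerSeries.derivative ℂ (A * B))) =
      PowerSeries.C (-w * (a + b)) * (A * B) +
        PowerSeries.X * (PowerSeries.C (2 * w * a * b) * (A * B)) := by
    rw [Derivation.leibniz, smul_eq_mul, smul_eq_mul]
    simp only [map_neg, map_mul, map_add, map_ofNat] at h1 h2 ⊢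
    linear_combination B * (1 - PowerSeries.C b * PowerSeries.X) * h1 +
      A * (1 - PowerSeries.C a * PowerSeries.X) * h2
  refine ⟨?_, fun n => ?_⟩
  · have := congrArg (PowerSeries.coeff 0) h3
    simp only [map_add, PowerSeries.coeff_zero_X_mul, add_zero, PowerSeries.coeff_C_mul, h0,
      PowerSeries.coeff_derivative] at this
    simpa using this
  · have := congrArg (PowerSeries.coeff (n + 1)) h3
    have hX : PowerSeries.coeff n (PowerSeries.X * PowerSeries.derivative ℂ (A * B)) =
        n * PowerSeries.coeff n (A * B) := by
      rcases n with _ | n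
      · simp
      · rw [PowerSeries.coeff_succ_X_mul, PowerSeries.coeff_derivative]
        push_cast
        ring
    simp only [map_add, PowerSeries.coeff_succ_X_mul, PowerSeries.coeff_C_mul, hX,
      PowerSeries.coeff_derivative] at this
    push_cast at this
    linear_combination this

lemma coeff_mul_oneSubPow_eq_gegenbauer {a b : ℂ} (ha : ‖a‖ = 1) (hb : ‖b‖ = 1)
    (hab : a * b = 1) {t s : ℝ} (hs : 0 < s) (ht : a + b = 2 * t) (n : ℕ) :
    PowerSeries.coeff n
        (taylorAtZero (oneSubPow a (-s)) * taylorAtZero (oneSubPow b (-s))) =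
      (gegenbauer s t n : ℂ) := by
  obtain ⟨h1, hr⟩ := coeff_mul_oneSubPow_recurrence ha hb (-s)
  induction n using Nat.strong_induction_on with
  | _ n ih =>
    rcases n with _ | _ | n
    · have hA := constantCoeff_taylorAtZero_oneSubPow a (-s)
      have hB := constantCoeff_taylorAtZero_oneSubPow b (-s)
      rw [PowerSeries.coeff_mul]
      simp [hA, hB, gegenbauer, gegenbauerCoef, risingFact]
    · rw [h1, ht]
      simp [gegenbauer, gegenbauerCoef, risingFact]
      ring
    · have h2 := hr n
      rw [ih n (by omega), ih (n + 1) (by omega), ht, hab] at h2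
      have h3 := congrArg (fun x : ℝ => (x : ℂ)) (gegenbauer_recurrence hs t n)
      push_cast at h3
      have h4 : (n : ℂ) + 2 ≠ 0 := by exact_mod_cast (n + 1).succ_ne_zero
      apply mul_left_cancel₀ h4
      linear_combination h2 - h3

/-- The coefficient of `v ^ j` in `(1 - v) ^ (-z - 1)`. -/
def cesaroCoef (z : ℂ) (j : ℕ) : ℂ := ∏ m ∈ Finset.range j, (1 + z / (m + 1))

lemma coeff_mul_oneSubPow_eq_cesaroCoef (z : ℂ) (j : ℕ) :
    PowerSeries.coeff (2 * j)
        (taylorAtZero (oneSubPow 1 (-z - 1)) * taylorAtZero (oneSubPow (-1) (-z - 1))) =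
      cesaroCoef z j ∧
    PowerSeries.coeff (2 * j + 1)
        (taylorAtZero (oneSubPow 1 (-z - 1)) * taylorAtZero (oneSubPow (-1) (-z - 1))) = 0 := by
  obtain ⟨h1, hr⟩ := coeff_mul_oneSubPow_recurrence (a := 1) (b := -1) (by simp) (by simp) (-z - 1)
  induction j with
  | zero =>
    refine ⟨?_, by simpa using h1⟩
    have hA := constantCoeff_taylorAtZero_oneSubPow 1 (-z - 1)
    have hB := constantCoeff_taylorAtZero_oneSubPow (-1) (-z - 1)
    rw [mul_zero, PowerSeries.coeff_mul]
    simp [hA, hB, cesaroCoef]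
  | succ j ih =>
    constructor
    · have h2 := hr (2 * j)
      rw [ih.1] at h2
      have h4 : (2 : ℂ) * j + 2 ≠ 0 := by exact_mod_cast (2 * j + 1).succ_ne_zero
      have h5 : (j : ℂ) + 1 ≠ 0 := by exact_mod_cast j.succ_ne_zero
      rw [cesaroCoef, Finset.prod_range_succ, ← cesaroCoef, mul_add, mul_one]
      push_cast at h2
      apply mul_left_cancel₀ h4
      rw [h2]
      field_simp
      ring
    · have h2 := hr (2 * j + 1)
      rw [ih.2] at h2
      have h4 : (2 : ℂ) * j + 1 + 2 ≠ 0 := by exact_mod_cast (2 * j + 2).succ_ne_zero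
      push_cast at h2
      rw [show 2 * (j + 1) + 1 = 2 * j + 1 + 2 by ring]
      simpa [h4] using h2

lemma coeff_one_sub_sq_mul {a b : ℂ} (ha : ‖a‖ = 1) (hb : ‖b‖ = 1)
    (hab : a * b = 1) {t : ℝ} {d : ℕ} (hd : 0 < d) (ht : a + b = 2 * t) (k : ℕ) :
    PowerSeries.coeff k ((1 - PowerSeries.X * PowerSeries.X) *
      (taylorAtZero (oneSubPow a (-((d : ℝ) / 2 : ℝ))) *
        taylorAtZero (oneSubPow b (-((d : ℝ) / 2 : ℝ))))) =
      (((sphMeasure d).real Set.univ * zonalFn d k t : ℝ) : ℂ) := by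
  have hs : (0 : ℝ) < (d : ℝ) / 2 := by positivity
  have hS := (sphMeasure_real_univ_pos hd).ne'
  rw [zonalFn, mul_inv_cancel_left₀ hS, sub_mul, one_mul, map_sub,
    coeff_mul_oneSubPow_eq_gegenbauer ha hb hab hs ht, mul_assoc]
  rcases k with _ | _ | k
  · simp [gegenbauer, zonalCoef]
  · rw [PowerSeries.coeff_succ_X_mul]
    simp [gegenbauer, zonalCoef]
  · rw [PowerSeries.coeff_succ_X_mul, PowerSeries.coeff_succ_X_mul,
      coeff_mul_oneSubPow_eq_gegenbauer ha hb hab hs ht, ← Complex.ofReal_sub, gegenbauer,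
      gegenbauer, show (k + 1 + 1) / 2 = k / 2 + 1 by omega, Finset.sum_range_succ',
      Finset.sum_range_succ' (n := k / 2 + 1), add_sub_right_comm, ← Finset.sum_sub_distrib]
    congr 2
    refine Finset.sum_congr rfl fun m _ => ?_
    rw [show k + 1 + 1 - 2 * (m + 1) = k - 2 * m by omega, zonalCoef]
    ring

/-- The generating function of the Cesàro type sums of zonal kernels. -/
def zonalGen (a b z : ℂ) (s : ℝ) (u : ℂ) : ℂ :=
  (oneSubPow 1 (-z) u * oneSubPow (-1) (-z) u) * (oneSubPow a (-s) u * oneSubPow b (-s) u)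

lemma coeff_taylorAtZero_zonalGen {a b : ℂ} (ha : ‖a‖ = 1) (hb : ‖b‖ = 1)
    (hab : a * b = 1) {t : ℝ} {d : ℕ} (hd : 0 < d) (ht : a + b = 2 * t) (z : ℂ) (n : ℕ) :
    PowerSeries.coeff n (taylorAtZero (zonalGen a b z ((d : ℝ) / 2))) =
      ∑ j ∈ Finset.range (n / 2 + 1), cesaroCoef z j *
        (((sphMeasure d).real Set.univ * zonalFn d (n - 2 * j) t : ℝ) : ℂ) := by
  have h1 : ‖(1 : ℂ)‖ = 1 := by simp
  have h2 : ‖(-1 : ℂ)‖ = 1 := by simp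
  have hT : taylorAtZero (zonalGen a b z ((d : ℝ) / 2)) =
      (taylorAtZero (oneSubPow 1 (-z - 1)) * taylorAtZero (oneSubPow (-1) (-z - 1))) *
      ((1 - PowerSeries.X * PowerSeries.X) *
      (taylorAtZero (oneSubPow a (-((d : ℝ) / 2 : ℝ))) *
        taylorAtZero (oneSubPow b (-((d : ℝ) / 2 : ℝ))))) := by
    have e1 := analyticAt_oneSubPow h1 (-z)
    have e2 := analyticAt_oneSubPow h2 (-z)
    have e3 := analyticAt_oneSubPow ha (-((d : ℝ) / 2 : ℝ))
    have e4 := analyticAt_oneSubPow hb (-((d : ℝ) / 2 : ℝ))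
    unfold zonalGen
    rw [taylorAtZero_mul (e1.fun_mul e2) (e3.fun_mul e4), taylorAtZero_mul e1 e2,
      taylorAtZero_mul e3 e4, taylorAtZero_oneSubPow_eq_mul h1 (-z),
      taylorAtZero_oneSubPow_eq_mul h2 (-z)]
    simp only [map_one, map_neg]
    ring
  rw [hT, PowerSeries.coeff_mul, Finset.Nat.sum_antidiagonal_eq_sum_range_succ_mk]
  simp only [coeff_one_sub_sq_mul ha hb hab hd ht]
  have hi : Set.InjOn (fun j : ℕ => 2 * j) (Finset.range (n / 2 + 1)) :=
    fun i _ j _ h => by simpa using h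
  have hsum := Finset.sum_image (f := fun i => PowerSeries.coeff i
    (taylorAtZero (oneSubPow 1 (-z - 1)) * taylorAtZero (oneSubPow (-1) (-z - 1))) *
      (((sphMeasure d).real Set.univ * zonalFn d (n - i) t : ℝ) : ℂ)) hi
  simp only [(coeff_mul_oneSubPow_eq_cesaroCoef z _).1] at hsum
  rw [← hsum]
  symm
  refine Finset.sum_subset ?_ ?_
  · intro i hi'
    simp only [Finset.mem_image, Finset.mem_range] at hi' ⊢
    omega
  · intro i hi1 hi2
    simp only [Finset.mem_image, Finset.mem_range, not_exists, not_and] at hi1 hi2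
    obtain ⟨j, rfl⟩ : ∃ j, i = 2 * j + 1 := by
      rcases Nat.even_or_odd' i with ⟨j, rfl | rfl⟩
      · exact absurd rfl (hi2 j (by omega))
      · exact ⟨j, rfl⟩
    rw [(coeff_mul_oneSubPow_eq_cesaroCoef z j).2, zero_mul]

lemma norm_oneSubPow_le {a u : ℂ} (ha : ‖a‖ = 1) (hu : ‖u‖ < 1) (w : ℂ) :
    ‖oneSubPow a w u‖ ≤ ‖1 - a * u‖ ^ w.re * Real.exp (Real.pi / 2 * |w.im|) := by
  have hpos := re_one_sub_mul_pos ha hu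
  have hne : 1 - a * u ≠ 0 := fun h => by simp [h] at hpos
  rw [oneSubPow, Complex.norm_cpow_of_ne_zero hne, div_eq_mul_inv, ← Real.exp_neg]
  gcongr
  have h1 : |Complex.arg (1 - a * u)| ≤ Real.pi / 2 :=
    Complex.abs_arg_le_pi_div_two_iff.mpr hpos.le
  calc -(Complex.arg (1 - a * u) * w.im) ≤ |Complex.arg (1 - a * u) * w.im| := neg_le_abs _
    _ = |Complex.arg (1 - a * u)| * |w.im| := abs_mul _ _
    _ ≤ _ := by gcongr

lemma div_rpow_add_le {x y s : ℝ} (hx : 0 < x) (hy : 0 < y) (hs : 0 ≤ s) :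
    (x + y) ^ s * (x ^ (-s) * y ^ (-s)) ≤ 2 ^ s * (x ^ (-s) + y ^ (-s)) := by
  wlog h : x ≤ y generalizing x y
  · have := this hy hx (le_of_not_ge h)
    rwa [add_comm y x, mul_comm (y ^ (-s)), add_comm (y ^ (-s))] at this
  calc (x + y) ^ s * (x ^ (-s) * y ^ (-s)) ≤ (2 * y) ^ s * (x ^ (-s) * y ^ (-s)) := by
        gcongr; linarith
    _ = 2 ^ s * x ^ (-s) * (y ^ s * y ^ (-s)) := by
        rw [Real.mul_rpow (by norm_num) hy.le]; ring
    _ = 2 ^ s * x ^ (-s) := by rw [← Real.rpow_add hy]; simp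
    _ ≤ _ := by gcongr; linarith [Real.rpow_nonneg hy.le (-s)]

lemma norm_zonalGen_le {a b u z : ℂ} (ha : ‖a‖ = 1) (hb : ‖b‖ = 1) (hab : a * b = 1)
    (hu : ‖u‖ < 1) {s τ : ℝ} (hs : 0 ≤ s) (hτ : s ≤ τ) (hz : z.re = -τ) :
    ‖zonalGen a b z s u‖ ≤ 2 ^ τ * Real.exp (Real.pi * |z.im|) *
      (‖1 - a * u‖ ^ (-s) + ‖1 - b * u‖ ^ (-s)) := by
  have hx : 0 < ‖1 - a * u‖ := norm_pos_iff.mpr fun h => by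
    simpa [h] using re_one_sub_mul_pos ha hu
  have hy : 0 < ‖1 - b * u‖ := norm_pos_iff.mpr fun h => by
    simpa [h] using re_one_sub_mul_pos hb hu
  have e1 := norm_oneSubPow_le (a := 1) (by simp) hu (-z)
  have e2 := norm_oneSubPow_le (a := -1) (by simp) hu (-z)
  have e3 : ∀ c : ℂ, ‖oneSubPow c (-(s : ℂ)) u‖ = ‖1 - c * u‖ ^ (-s) := fun c => by
    rw [oneSubPow, ← Complex.ofReal_neg, Complex.norm_cpow_real]
  have hprod : ‖1 - 1 * u‖ * ‖1 - -1 * u‖ = ‖1 - u ^ 2‖ := by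
    rw [← norm_mul]; congr 1; ring
  have hle2 : ‖1 - u ^ 2‖ ≤ 2 := by
    calc ‖1 - u ^ 2‖ ≤ ‖(1 : ℂ)‖ + ‖u ^ 2‖ := norm_sub_le _ _
      _ ≤ 1 + 1 := by
        rw [norm_pow, norm_one]; gcongr; exact pow_le_one₀ (norm_nonneg _) hu.le
      _ = 2 := by norm_num
  have hle : ‖1 - u ^ 2‖ ≤ ‖1 - a * u‖ + ‖1 - b * u‖ := by
    calc ‖1 - u ^ 2‖ = ‖(1 - a * u) + a * u * (1 - b * u)‖ := by
          congr 1; linear_combination u ^ 2 * hab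
      _ ≤ ‖1 - a * u‖ + ‖a * u * (1 - b * u)‖ := norm_add_le _ _
      _ ≤ _ := by
        rw [norm_mul, norm_mul, ha, one_mul]
        gcongr
        exact mul_le_of_le_one_left (norm_nonneg _) hu.le
  have hpow : ‖1 - u ^ 2‖ ^ τ ≤ 2 ^ (τ - s) * (‖1 - a * u‖ + ‖1 - b * u‖) ^ s := by
    rcases (norm_nonneg (1 - u ^ 2)).eq_or_lt with h0 | h0
    · rw [← h0]
      rcases (hs.trans hτ).eq_or_lt with h | h
      · obtain rfl : s = 0 := le_antisymm (h ▸ hτ) hs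
        simp [← h]
      · rw [Real.zero_rpow h.ne']; positivity
    calc ‖1 - u ^ 2‖ ^ τ = ‖1 - u ^ 2‖ ^ (τ - s) * ‖1 - u ^ 2‖ ^ s := by
          rw [← Real.rpow_add h0]; simp
      _ ≤ _ := by
          gcongr
  simp only [Complex.neg_re, hz, neg_neg, Complex.neg_im, abs_neg] at e1 e2
  rw [zonalGen, norm_mul, norm_mul, norm_mul, e3, e3]
  calc _ ≤ ((‖1 - 1 * u‖ ^ τ * Real.exp (Real.pi / 2 * |z.im|)) *
        (‖1 - -1 * u‖ ^ τ * Real.exp (Real.pi / 2 * |z.im|))) *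
        (‖1 - a * u‖ ^ (-s) * ‖1 - b * u‖ ^ (-s)) := by gcongr
    _ = Real.exp (Real.pi * |z.im|) * (‖1 - u ^ 2‖ ^ τ *
        (‖1 - a * u‖ ^ (-s) * ‖1 - b * u‖ ^ (-s))) := by
        rw [← hprod, Real.mul_rpow (norm_nonneg _) (norm_nonneg _),
          show Real.pi * |z.im| = Real.pi / 2 * |z.im| + Real.pi / 2 * |z.im| by ring, Real.exp_add]
        ring
    _ ≤ Real.exp (Real.pi * |z.im|) * ((2 ^ (τ - s) * (‖1 - a * u‖ + ‖1 - b * u‖) ^ s) *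
        (‖1 - a * u‖ ^ (-s) * ‖1 - b * u‖ ^ (-s))) := by gcongr
    _ ≤ Real.exp (Real.pi * |z.im|) * (2 ^ (τ - s) *
        (2 ^ s * (‖1 - a * u‖ ^ (-s) + ‖1 - b * u‖ ^ (-s)))) := by
        rw [mul_assoc (2 ^ (τ - s))]
        exact mul_le_mul_of_nonneg_left (mul_le_mul_of_nonneg_left (div_rpow_add_le hx hy hs)
          (by positivity)) (by positivity)
    _ = _ := by
        rw [← mul_assoc (2 ^ (τ - s)), ← Real.rpow_add (by norm_num)]
        simp only [sub_add_cancel]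
        ring

lemma sq_add_sq_div_five_le {r θ : ℝ} (hr : 1 / 2 ≤ r) (hθ : |θ| ≤ Real.pi) :
    ((1 - r) ^ 2 + θ ^ 2) / 5 ≤ ‖1 - circleMap 0 r θ‖ ^ 2 := by
  have h1 : ‖1 - circleMap 0 r θ‖ ^ 2 = (1 - r) ^ 2 + 2 * r * (1 - Real.cos θ) := by
    rw [← Complex.normSq_eq_norm_sq, Complex.normSq_apply, circleMap]
    simp only [zero_add, Complex.sub_re, Complex.one_re, Complex.re_ofReal_mul,
      Complex.exp_ofReal_mul_I_re, Complex.sub_im, Complex.one_im, Complex.im_ofReal_mul,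
      Complex.exp_ofReal_mul_I_im]
    linear_combination r ^ 2 * Real.sin_sq_add_cos_sq θ
  have h2 := Real.cos_le_one_sub_mul_cos_sq hθ
  have hpi : (1 : ℝ) / 5 ≤ 2 / Real.pi ^ 2 := by
    rw [div_le_div_iff₀ (by norm_num) (by positivity)]
    nlinarith [Real.pi_lt_d2, Real.pi_pos]
  have h3 : 1 / 5 * θ ^ 2 ≤ 2 / Real.pi ^ 2 * θ ^ 2 := by gcongr
  have h4 : θ ^ 2 / 5 ≤ 1 - Real.cos θ := by linarith
  have h5 : 0 ≤ 1 - Real.cos θ := by linarith [Real.cos_le_one θ]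
  rw [h1]
  nlinarith [sq_nonneg (1 - r)]

lemma one_sub_circleMap_ne_zero {r : ℝ} (hr0 : 0 ≤ r) (hr : r < 1) (θ : ℝ) :
    1 - circleMap 0 r θ ≠ 0 := fun h => by
  have : ‖circleMap 0 r θ‖ = 1 := by rw [← sub_eq_zero.mp h, norm_one]
  rw [norm_circleMap_zero, abs_of_nonneg hr0] at this
  exact hr.ne this

lemma integral_norm_one_sub_circleMap_rpow_le {r s : ℝ} (hs : 1 < s) (hr : 1 / 2 ≤ r)
    (hr1 : r < 1) (α : ℝ) :
    ∫ θ in 0..2 * Real.pi, ‖1 - circleMap 0 r (θ + α)‖ ^ (-s) ≤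
      5 ^ (s / 2) * (1 - r) ^ (1 - s) * ∫ θ : ℝ, (1 + ‖θ‖ ^ 2) ^ (-s / 2) := by
  have hδ : 0 < 1 - r := by linarith
  set g : ℝ → ℝ := fun θ => ‖1 - circleMap 0 r θ‖ ^ (-s) with hg
  have hcont : Continuous g :=
    Continuous.rpow_const (by fun_prop)
      fun θ => Or.inl (norm_ne_zero_iff.mpr (one_sub_circleMap_ne_zero (by linarith) hr1 θ))
  have hper : Function.Periodic g (2 * Real.pi) := fun θ => by
    simp only [hg, periodic_circleMap 0 r θ]
  have hint := integrable_rpow_neg_one_add_norm_sq (E := ℝ) (μ := volume) (r := s) (by simpa)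
  have key : ∀ θ ∈ Set.Icc (-Real.pi) Real.pi,
      g θ ≤ 5 ^ (s / 2) * (1 - r) ^ (-s) * (1 + ‖θ / (1 - r)‖ ^ 2) ^ (-s / 2) := by
    intro θ hθ
    have h1 := sq_add_sq_div_five_le hr (abs_le.mpr hθ)
    have h2 : g θ = (‖1 - circleMap 0 r θ‖ ^ 2) ^ (-s / 2) := by
      rw [← Real.rpow_natCast, ← Real.rpow_mul (norm_nonneg _)]
      simp only [hg]; congr 1; push_cast; ring
    have h3 : ((1 - r) ^ 2 + θ ^ 2) / 5 = 5⁻¹ * (1 - r) ^ 2 * (1 + ‖θ / (1 - r)‖ ^ 2) := by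
      rw [Real.norm_eq_abs, sq_abs]; field_simp
    rw [h2]
    calc _ ≤ (((1 - r) ^ 2 + θ ^ 2) / 5) ^ (-s / 2) :=
          Real.rpow_le_rpow_of_nonpos (by positivity) h1 (by linarith)
      _ = _ := by
        rw [h3, Real.mul_rpow (by positivity) (by positivity),
          Real.mul_rpow (by positivity) (by positivity), Real.inv_rpow (by norm_num),
          ← Real.rpow_neg (by norm_num), ← Real.rpow_natCast (1 - r), ← Real.rpow_mul hδ.le]
        congr 3
        · ring
        · push_cast; ring
  have hint' : Integrable fun θ : ℝ =>
      5 ^ (s / 2) * (1 - r) ^ (-s) * (1 + ‖θ / (1 - r)‖ ^ 2) ^ (-s / 2) :=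
    (hint.comp_div hδ.ne').const_mul _
  calc ∫ θ in 0..2 * Real.pi, g (θ + α) = ∫ θ in α..α + 2 * Real.pi, g θ := by
        rw [intervalIntegral.integral_comp_add_right, zero_add, add_comm]
    _ = ∫ θ in (-Real.pi)..Real.pi, g θ := by
        rw [hper.intervalIntegral_add_eq α (-Real.pi)]
        congr 1; ring
    _ ≤ ∫ θ in (-Real.pi)..Real.pi,
        5 ^ (s / 2) * (1 - r) ^ (-s) * (1 + ‖θ / (1 - r)‖ ^ 2) ^ (-s / 2) :=
        intervalIntegral.integral_mono_on (by linarith [Real.pi_pos])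
          (hcont.intervalIntegrable _ _) hint'.intervalIntegrable key
    _ ≤ ∫ θ : ℝ, 5 ^ (s / 2) * (1 - r) ^ (-s) * (1 + ‖θ / (1 - r)‖ ^ 2) ^ (-s / 2) := by
        rw [intervalIntegral.integral_of_le (by linarith [Real.pi_pos])]
        exact setIntegral_le_integral hint' (Filter.Eventually.of_forall fun θ => by positivity)
    _ = _ := by
        rw [integral_const_mul,
          Measure.integral_comp_div (fun θ : ℝ => (1 + ‖θ‖ ^ 2) ^ (-s / 2)) (1 - r),
          abs_of_pos hδ, smul_eq_mul, ← mul_assoc, mul_assoc (5 ^ (s / 2))]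
        congr 2
        rw [sub_eq_add_neg 1 s, Real.rpow_add hδ, Real.rpow_one, mul_comm]

lemma exists_norm_sum_cesaroCoef_mul_zonalFn_le {d : ℕ} (hd : 3 ≤ d) {τ : ℝ}
    (hτ : (d : ℝ) / 2 ≤ τ) :
    ∃ C : ℝ, 0 < C ∧ ∀ n : ℕ, 1 ≤ n → ∀ z : ℂ, z.re = -τ → ∀ t ∈ Set.Icc (-1 : ℝ) 1,
      ‖∑ j ∈ Finset.range (n / 2 + 1), cesaroCoef z j * (zonalFn d (n - 2 * j) t : ℂ)‖ ≤
        C * Real.exp (Real.pi * |z.im|) * (n : ℝ) ^ (((d : ℝ) - 2) / 2) := by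
  set s : ℝ := (d : ℝ) / 2 with hs
  have hs1 : 1 < s := by
    have : (3 : ℝ) ≤ d := by exact_mod_cast hd
    linarith
  set V := (sphMeasure d).real Set.univ
  have hV : 0 < V := sphMeasure_real_univ_pos (by omega)
  set K := ∫ θ : ℝ, (1 + ‖θ‖ ^ 2) ^ (-s / 2)
  have hK : 0 ≤ K := integral_nonneg fun θ => by positivity
  set B := (2 * Real.pi)⁻¹ * (2 ^ τ * (2 * (5 ^ (s / 2) * 2 ^ (s - 1) * K))) * Real.exp 1
  have hB : 0 ≤ B := by positivity
  refine ⟨V⁻¹ * B + 1, by positivity, fun n hn z hz t ht => ?_⟩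
  set a : ℂ := Complex.exp (Real.arccos t * Complex.I)
  set b : ℂ := Complex.exp ((-Real.arccos t : ℝ) * Complex.I)
  have ha : ‖a‖ = 1 := Complex.norm_exp_ofReal_mul_I _
  have hb : ‖b‖ = 1 := Complex.norm_exp_ofReal_mul_I _
  have hab : a * b = 1 := by
    rw [← Complex.exp_add]; simp
  have hadd : a + b = 2 * t := by
    have := Complex.two_cos (Real.arccos t)
    rw [← Complex.ofReal_cos, Real.cos_arccos ht.1 ht.2] at this
    rw [this]; simp [a, b]
  have hn0 : (1 : ℝ) ≤ n := by exact_mod_cast hn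
  set r : ℝ := n / (n + 1) with hr
  have hr0 : 1 / 2 ≤ r := by rw [hr, div_le_div_iff₀] <;> linarith
  have hr1 : r < 1 := by rw [hr, div_lt_one] <;> linarith
  have h1r : 1 - r = ((n : ℝ) + 1)⁻¹ := by rw [hr]; field_simp; ring
  have hpow : (1 - r) ^ (1 - s) ≤ 2 ^ (s - 1) * (n : ℝ) ^ (s - 1) := by
    rw [h1r, Real.inv_rpow (by positivity), ← Real.rpow_neg (by positivity), neg_sub,
      ← Real.mul_rpow (by norm_num) (by positivity)]
    exact Real.rpow_le_rpow (by positivity) (by linarith) (by linarith)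
  have hinv : r⁻¹ ^ n ≤ Real.exp 1 := by
    have : r⁻¹ = 1 / (n : ℝ) + 1 := by rw [hr]; field_simp; ring
    calc r⁻¹ ^ n ≤ Real.exp (1 / (n : ℝ)) ^ n := by
          rw [this]; gcongr; exact Real.add_one_le_exp _
      _ = Real.exp 1 := by
          rw [← Real.exp_nat_mul]; congr 1; field_simp
  have hcm : ∀ β θ : ℝ, Complex.exp (β * Complex.I) * circleMap 0 r θ = circleMap 0 r (θ + β) := by
    intro β θ
    simp only [circleMap, zero_add, Complex.ofReal_add, add_mul, Complex.exp_add]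
    ring
  have hint : ∀ β : ℝ, ∫ θ in 0..2 * Real.pi,
      ‖1 - Complex.exp (β * Complex.I) * circleMap 0 r θ‖ ^ (-s) ≤
        5 ^ (s / 2) * (2 ^ (s - 1) * (n : ℝ) ^ (s - 1)) * K := by
    intro β
    simp only [hcm]
    refine (integral_norm_one_sub_circleMap_rpow_le hs1 hr0 hr1 β).trans ?_
    gcongr
  have hcont : ∀ β : ℝ, Continuous fun θ : ℝ =>
      ‖1 - Complex.exp (β * Complex.I) * circleMap 0 r θ‖ ^ (-s) := fun β => by
    simp only [hcm]
    exact Continuous.rpow_const (by fun_prop) fun θ => Or.inl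
      (norm_ne_zero_iff.mpr (one_sub_circleMap_ne_zero (by linarith) hr1 _))
  have hdiff : DifferentiableOn ℂ (zonalGen a b z s) (ball 0 1) :=
    ((differentiableOn_oneSubPow (by simp) _).mul (differentiableOn_oneSubPow (by simp) _)).mul
      ((differentiableOn_oneSubPow ha _).mul (differentiableOn_oneSubPow hb _))
  have hball : ∀ θ, ‖circleMap 0 r θ‖ < 1 := fun θ => by
    rw [norm_circleMap_zero, abs_of_nonneg (by linarith)]; exact hr1
  have hcontZ : Continuous fun θ : ℝ => ‖zonalGen a b z s (circleMap 0 r θ)‖ :=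
    (hdiff.continuousOn.comp_continuous (continuous_circleMap 0 r)
      fun θ => by simpa using hball θ).norm
  have hI : ∫ θ in 0..2 * Real.pi, ‖zonalGen a b z s (circleMap 0 r θ)‖ ≤
      2 ^ τ * Real.exp (Real.pi * |z.im|) *
        (2 * (5 ^ (s / 2) * (2 ^ (s - 1) * (n : ℝ) ^ (s - 1)) * K)) := by
    calc _ ≤ ∫ θ in 0..2 * Real.pi, 2 ^ τ * Real.exp (Real.pi * |z.im|) *
        (‖1 - a * circleMap 0 r θ‖ ^ (-s) + ‖1 - b * circleMap 0 r θ‖ ^ (-s)) :=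
          intervalIntegral.integral_mono_on (by positivity) (hcontZ.intervalIntegrable _ _)
            (((((hcont _).add (hcont _)).const_mul _)).intervalIntegrable _ _)
            fun θ _ => norm_zonalGen_le ha hb hab (hball θ) (by linarith) hτ hz
      _ = 2 ^ τ * Real.exp (Real.pi * |z.im|) *
          ((∫ θ in 0..2 * Real.pi, ‖1 - a * circleMap 0 r θ‖ ^ (-s)) +
            ∫ θ in 0..2 * Real.pi, ‖1 - b * circleMap 0 r θ‖ ^ (-s)) := by
          rw [intervalIntegral.integral_const_mul, intervalIntegral.integral_add
            ((hcont _).intervalIntegrable _ _) ((hcont _).intervalIntegrable _ _)]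
      _ ≤ _ := by
          refine mul_le_mul_of_nonneg_left ?_ (by positivity)
          exact (add_le_add (hint _) (hint _)).trans_eq (two_mul _).symm
  have hcoeff := norm_coeff_taylorAtZero_le hdiff (r := r) (by linarith) hr1 n
  rw [coeff_taylorAtZero_zonalGen ha hb hab (by omega) hadd] at hcoeff
  have hsum : ∑ j ∈ Finset.range (n / 2 + 1),
      cesaroCoef z j * ((V * zonalFn d (n - 2 * j) t : ℝ) : ℂ) =
      (V : ℂ) * ∑ j ∈ Finset.range (n / 2 + 1),
        cesaroCoef z j * (zonalFn d (n - 2 * j) t : ℂ) := by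
    rw [Finset.mul_sum]
    refine Finset.sum_congr rfl fun j _ => ?_
    push_cast; ring
  rw [hsum, norm_mul, Complex.norm_real, Real.norm_of_nonneg hV.le] at hcoeff
  have hfin : V * ‖∑ j ∈ Finset.range (n / 2 + 1),
      cesaroCoef z j * (zonalFn d (n - 2 * j) t : ℂ)‖ ≤
      B * (Real.exp (Real.pi * |z.im|) * (n : ℝ) ^ (s - 1)) := by
    refine hcoeff.trans ?_
    calc _ ≤ ((2 * Real.pi)⁻¹ * (2 ^ τ * Real.exp (Real.pi * |z.im|) *
        (2 * (5 ^ (s / 2) * (2 ^ (s - 1) * (n : ℝ) ^ (s - 1)) * K)))) * Real.exp 1 := by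
          gcongr
      _ = _ := by ring
  rw [show ((d : ℝ) - 2) / 2 = s - 1 by rw [hs]; ring]
  calc _ = V⁻¹ * (V * ‖∑ j ∈ Finset.range (n / 2 + 1),
      cesaroCoef z j * (zonalFn d (n - 2 * j) t : ℂ)‖) := by field_simp
    _ ≤ V⁻¹ * (B * (Real.exp (Real.pi * |z.im|) * (n : ℝ) ^ (s - 1))) := by gcongr
    _ ≤ _ := by
      have : 0 ≤ Real.exp (Real.pi * |z.im|) * (n : ℝ) ^ (s - 1) := by positivity
      linarith

lemma differentiable_cesaroCoef (j : ℕ) : Differentiable ℂ fun z => cesaroCoef z j := by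
  unfold cesaroCoef
  fun_prop

lemma cesaroCoef_neg_one (j : ℕ) : cesaroCoef (-1) j = if j = 0 then 1 else 0 := by
  rcases j with _ | j
  · simp [cesaroCoef]
  · rw [cesaroCoef, Finset.prod_range_succ']
    simp

lemma norm_cesaroCoef_le (z : ℂ) (j : ℕ) : ‖cesaroCoef z j‖ ≤ Real.exp (j * ‖z‖) := by
  rw [cesaroCoef, norm_prod, Real.exp_nat_mul]
  calc _ ≤ ∏ _m ∈ Finset.range j, Real.exp ‖z‖ := by
        refine Finset.prod_le_prod (fun _ _ => norm_nonneg _) fun m _ => ?_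
        calc ‖1 + z / (m + 1)‖ ≤ ‖(1 : ℂ)‖ + ‖z / (m + 1)‖ := norm_add_le _ _
          _ ≤ 1 + ‖z‖ := by
            rw [norm_one, norm_div]
            gcongr
            refine div_le_self (norm_nonneg _) ?_
            rw [show (m : ℂ) + 1 = ((m + 1 : ℕ) : ℂ) by push_cast; rfl, Complex.norm_natCast]
            exact_mod_cast Nat.succ_pos m
          _ ≤ _ := by rw [add_comm]; exact Real.add_one_le_exp _
    _ = _ := by simp

lemma sum_inv_succ_sq_le (j : ℕ) :
    ∑ m ∈ Finset.range j, (1 : ℝ) / ((m : ℝ) + 1) ^ 2 ≤ 2 := by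
  have : ∑ m ∈ Finset.range j, (1 : ℝ) / ((m : ℝ) + 1) ^ 2 ≤ 2 - 1 / (j : ℝ) := by
    induction j with
    | zero => norm_num
    | succ j ih =>
      rw [Finset.sum_range_succ]
      rcases Nat.eq_zero_or_pos j with rfl | hj
      · norm_num
      have hj' : (0 : ℝ) < j := by exact_mod_cast hj
      have h1 : (1 : ℝ) / ((j : ℝ) + 1) ^ 2 ≤ 1 / (j : ℝ) - 1 / ((j : ℝ) + 1) := by
        rw [div_sub_div _ _ hj'.ne' (by positivity),
          div_le_div_iff₀ (by positivity) (by positivity)]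
        nlinarith
      push_cast
      linarith
  exact this.trans (sub_le_self _ (by positivity))

lemma norm_cesaroCoef_mul_I_le (η : ℝ) (j : ℕ) :
    ‖cesaroCoef (η * Complex.I) j‖ ≤ Real.exp (η ^ 2) := by
  rw [cesaroCoef, norm_prod]
  calc _ ≤ ∏ m ∈ Finset.range j, Real.exp (η ^ 2 / 2 * (1 / ((m : ℝ) + 1) ^ 2)) := by
        refine Finset.prod_le_prod (fun _ _ => norm_nonneg _) fun m _ => ?_
        refine le_of_sq_le_sq ?_ (Real.exp_pos _).le
        rw [← Real.exp_nat_mul]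
        have : ‖1 + η * Complex.I / (m + 1)‖ ^ 2 = 1 + η ^ 2 * (1 / ((m : ℝ) + 1) ^ 2) := by
          rw [← Complex.normSq_eq_norm_sq,
            show 1 + η * Complex.I / ((m : ℂ) + 1) = (1 : ℝ) + (η / (m + 1) : ℝ) * Complex.I by
              push_cast; ring, Complex.normSq_add_mul_I, one_pow, div_pow]
          ring
        rw [this, add_comm]
        refine (Real.add_one_le_exp _).trans_eq ?_
        congr 1; push_cast; ring
    _ = Real.exp (η ^ 2 / 2 * ∑ m ∈ Finset.range j, 1 / ((m : ℝ) + 1) ^ 2) := by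
        rw [← Real.exp_sum, Finset.mul_sum]
    _ ≤ _ := by
        gcongr
        nlinarith [sum_inv_succ_sq_le j, sq_nonneg η]

section Interpolation

variable {ι : Type*} {H : Type*} [NormedAddCommGroup H] [InnerProductSpace ℝ H]

lemma norm_sum_mul_inner_le [Fintype ι] (c : ι → ℂ) (e : ι → H) :
    ‖∑ i, ∑ i', c i * c i' * ((inner ℝ (e i) (e i') : ℝ) : ℂ)‖ ≤
      ‖∑ i, (c i).re • e i‖ ^ 2 + ‖∑ i, (c i).im • e i‖ ^ 2 := by
  set U := ∑ i, (c i).re • e i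
  set W := ∑ i, (c i).im • e i
  have key : ∀ a b : ι → ℝ, inner ℝ (∑ i, a i • e i) (∑ i, b i • e i) =
      ∑ i, ∑ i', a i * b i' * inner ℝ (e i) (e i') := fun a b => by
    simp_rw [sum_inner, inner_sum, real_inner_smul_left, real_inner_smul_right, mul_assoc]
  have hUW : ∑ i, ∑ i', c i * c i' * ((inner ℝ (e i) (e i') : ℝ) : ℂ) =
      ((inner ℝ U U - inner ℝ W W : ℝ) : ℂ) +
        ((inner ℝ U W + inner ℝ W U : ℝ) : ℂ) * Complex.I := by
    simp only [U, W, key, Complex.ofReal_sub, Complex.ofReal_add, Complex.ofReal_sum,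
      Finset.sum_mul,
      ← Finset.sum_add_distrib, ← Finset.sum_sub_distrib]
    refine Finset.sum_congr rfl fun i _ => Finset.sum_congr rfl fun i' _ => ?_
    conv_lhs => rw [← Complex.re_add_im (c i), ← Complex.re_add_im (c i')]
    push_cast
    linear_combination ((c i).im * (c i').im * ((inner ℝ (e i) (e i') : ℝ) : ℂ)) * Complex.I_sq
  rw [hUW, real_inner_self_eq_norm_sq, real_inner_self_eq_norm_sq, real_inner_comm W U]
  refine le_of_sq_le_sq ?_ (by positivity)
  rw [← Complex.normSq_eq_norm_sq, Complex.normSq_add_mul_I]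
  have hcs : inner ℝ W U ^ 2 ≤ ‖U‖ ^ 2 * ‖W‖ ^ 2 := by
    rw [← mul_pow, ← sq_abs, mul_comm ‖U‖]
    gcongr
    exact abs_real_inner_le_norm W U
  nlinarith

/-- The analytic family of coefficients `sgn (v i) |v i| ^ ((1 + ζ) / (1 + t))`. -/
def analyticCoef (v : ι → ℝ) (t : ℝ) (ζ : ℂ) (i : ι) : ℂ :=
  (SignType.sign (v i) : ℝ) * ((|v i| : ℝ) : ℂ) ^ ((1 + ζ) / (1 + t))

lemma differentiable_analyticCoef {v : ι → ℝ} (hv : ∀ i, v i ≠ 0) (t : ℝ) (i : ι) :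
    Differentiable ℂ fun ζ => analyticCoef v t ζ i := by
  have : ((|v i| : ℝ) : ℂ) ≠ 0 := by simpa using hv i
  unfold analyticCoef
  exact (Differentiable.const_cpow (by fun_prop) (Or.inl this)).const_mul _

lemma norm_analyticCoef {v : ι → ℝ} (hv : ∀ i, v i ≠ 0) {t : ℝ} (ζ : ℂ) (i : ι) :
    ‖analyticCoef v t ζ i‖ = |v i| ^ ((1 + ζ.re) / (1 + t)) := by
  have h1 : ‖((SignType.sign (v i) : ℝ) : ℂ)‖ = 1 := by
    rcases lt_or_gt_of_ne (hv i) with h | h <;> simp [h]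
  rw [analyticCoef, norm_mul, h1, one_mul,
    Complex.norm_cpow_eq_rpow_re_of_pos (abs_pos.mpr (hv i))]
  congr 1
  rw [show (1 + (t : ℂ)) = ((1 + t : ℝ) : ℂ) by push_cast; rfl, Complex.div_ofReal_re]
  simp

lemma analyticCoef_self {v : ι → ℝ} {t : ℝ} (ht : 0 ≤ t) (i : ι) : analyticCoef v t t i = v i := by
  have : (1 + (t : ℂ)) ≠ 0 := by
    rw [show (1 + (t : ℂ)) = ((1 + t : ℝ) : ℂ) by push_cast; rfl]
    exact_mod_cast (by positivity : (1 + t) ≠ 0)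
  rw [analyticCoef, div_self this, Complex.cpow_one, ← Complex.ofReal_mul, sign_mul_abs]

/-- The analytic family of quadratic forms interpolated in the proof of
`norm_sum_smul_sq_le_of_cesaro`. -/
def cesaroFamily [Fintype ι] (N : ℕ) (v : ι → ℝ) (e : ℕ → ι → H) (τ : ℝ) (ζ : ℂ) : ℂ :=
  Complex.exp ((τ ^ 2 + 1) * (ζ - τ⁻¹) ^ 2) * ∑ j ∈ Finset.range N, cesaroCoef (-ζ * τ) j *
    ∑ i, ∑ i', analyticCoef v τ⁻¹ ζ i * analyticCoef v τ⁻¹ ζ i' *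
      ((inner ℝ (e j i) (e j i') : ℝ) : ℂ)

lemma differentiable_cesaroFamily [Fintype ι] (N : ℕ) {v : ι → ℝ} (hv : ∀ i, v i ≠ 0)
    (e : ℕ → ι → H) (τ : ℝ) :
    Differentiable ℂ (cesaroFamily N v e τ) := by
  unfold cesaroFamily
  refine Differentiable.mul (by fun_prop) (Differentiable.fun_sum fun j _ => Differentiable.mul
    ((differentiable_cesaroCoef j).comp (by fun_prop : Differentiable ℂ fun ζ : ℂ => -ζ * τ))
    (Differentiable.fun_sum fun i _ => Differentiable.fun_sum fun i' _ =>
    ((differentiable_analyticCoef hv _ i).mul (differentiable_analyticCoef hv _ i')).mul_const _))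

lemma norm_exp_mul_sub_sq_le {τ : ℝ} (hτ : 1 ≤ τ) {ζ : ℂ} (h0 : 0 ≤ ζ.re) (h1 : ζ.re ≤ 1) :
    ‖Complex.exp ((τ ^ 2 + 1) * (ζ - τ⁻¹) ^ 2)‖ ≤
      Real.exp (τ ^ 2 + 1) * Real.exp (-((τ ^ 2 + 1) * ζ.im ^ 2)) := by
  have hre : ((τ ^ 2 + 1) * (ζ - τ⁻¹) ^ 2 : ℂ).re =
      (τ ^ 2 + 1) * ((ζ.re - τ⁻¹) ^ 2 - ζ.im ^ 2) := by
    rw [show ((τ : ℂ) ^ 2 + 1) = ((τ ^ 2 + 1 : ℝ) : ℂ) by push_cast; rfl, Complex.re_ofReal_mul,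
      sq (ζ - _), Complex.mul_re]
    simp only [Complex.sub_re, Complex.ofReal_re, Complex.sub_im, Complex.ofReal_im]
    ring
  have hτ0 : 0 ≤ τ⁻¹ := by positivity
  have hτ1 : τ⁻¹ ≤ 1 := inv_le_one_of_one_le₀ hτ
  have hsq : (ζ.re - τ⁻¹) ^ 2 ≤ 1 := by nlinarith
  rw [Complex.norm_exp, hre, ← Real.exp_add]
  gcongr
  nlinarith [sq_nonneg τ]

lemma bddAbove_norm_cesaroFamily [Fintype ι] (N : ℕ) {v : ι → ℝ} (hv : ∀ i, v i ≠ 0)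
    (e : ℕ → ι → H) {τ : ℝ} (hτ : 1 ≤ τ) :
    BddAbove ((norm ∘ cesaroFamily N v e τ) ''
      Complex.HadamardThreeLines.verticalClosedStrip 0 1) := by
  set B : ι → ℝ := fun i => 1 + |v i| ^ (2 : ℝ)
  refine ⟨Real.exp (τ ^ 2 + 1) * ∑ j ∈ Finset.range N, Real.exp (j * τ + (j * τ) ^ 2) *
    ∑ i, ∑ i', B i * B i' * |inner ℝ (e j i) (e j i')|, ?_⟩
  rintro _ ⟨ζ, ⟨h0, h1⟩, rfl⟩
  have hτ0 : 0 ≤ τ⁻¹ := by positivity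
  have hB : ∀ i, ‖analyticCoef v τ⁻¹ ζ i‖ ≤ B i := fun i => by
    have hvi := abs_pos.mpr (hv i)
    rw [norm_analyticCoef hv]
    have hexp : (1 + ζ.re) / (1 + τ⁻¹) ≤ 2 := by
      rw [div_le_iff₀ (by positivity)]; linarith
    have hexp0 : 0 ≤ (1 + ζ.re) / (1 + τ⁻¹) := by positivity
    rcases le_total 1 |v i| with h | h
    · have := Real.rpow_le_rpow_of_exponent_le h hexp
      simp only [B]; linarith
    · have := Real.rpow_le_one hvi.le h hexp0
      have : 0 ≤ |v i| ^ (2 : ℝ) := by positivity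
      simp only [B]; linarith
  have hcoef : ∀ j : ℕ, Real.exp (-((τ ^ 2 + 1) * ζ.im ^ 2)) * ‖cesaroCoef (-ζ * τ) j‖ ≤
      Real.exp (j * τ + (j * τ) ^ 2) := fun j => by
    have hn : ‖-ζ * τ‖ ≤ (1 + |ζ.im|) * τ := by
      rw [norm_mul, norm_neg, Complex.norm_real, Real.norm_of_nonneg (by linarith)]
      gcongr
      refine (Complex.norm_le_abs_re_add_abs_im ζ).trans ?_
      gcongr
      exact abs_le.mpr ⟨by linarith, h1⟩
    calc _ ≤ Real.exp (-((τ ^ 2 + 1) * ζ.im ^ 2)) * Real.exp (j * ((1 + |ζ.im|) * τ)) := by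
          refine mul_le_mul_of_nonneg_left ((norm_cesaroCoef_le _ _).trans ?_) (Real.exp_pos _).le
          gcongr
      _ = Real.exp (-((τ ^ 2 + 1) * ζ.im ^ 2) + j * ((1 + |ζ.im|) * τ)) := by rw [Real.exp_add]
      _ ≤ _ := by
          refine Real.exp_le_exp.mpr ?_
          rw [← sq_abs ζ.im]
          nlinarith [sq_nonneg (|ζ.im| - j * τ), sq_nonneg (τ * |ζ.im|), sq_nonneg |ζ.im|,
            sq_nonneg (j * τ)]
  rw [Function.comp_apply, cesaroFamily, norm_mul]
  calc _ ≤ (Real.exp (τ ^ 2 + 1) * Real.exp (-((τ ^ 2 + 1) * ζ.im ^ 2))) *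
      ∑ j ∈ Finset.range N, ‖cesaroCoef (-ζ * τ) j‖ *
        ∑ i, ∑ i', B i * B i' * |inner ℝ (e j i) (e j i')| := by
        gcongr
        · exact norm_exp_mul_sub_sq_le hτ h0 h1
        · refine norm_sum_le_of_le _ fun j _ => ?_
          rw [norm_mul]
          gcongr
          refine norm_sum_le_of_le _ fun i _ => norm_sum_le_of_le _ fun i' _ => ?_
          rw [norm_mul, norm_mul, Complex.norm_real, Real.norm_eq_abs]
          have := (norm_nonneg _).trans (hB i)
          gcongr
          · exact hB i
          · exact hB i'
    _ ≤ _ := by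
        rw [mul_assoc, Finset.mul_sum (Finset.range N) _ (Real.exp (-((τ ^ 2 + 1) * ζ.im ^ 2)))]
        have hBn : ∀ i, 0 ≤ B i := fun i => (norm_nonneg _).trans (hB i)
        refine mul_le_mul_of_nonneg_left (Finset.sum_le_sum fun j _ => ?_) (Real.exp_pos _).le
        rw [← mul_assoc]
        refine mul_le_mul_of_nonneg_right (hcoef j) ?_
        exact Finset.sum_nonneg fun i _ => Finset.sum_nonneg fun i' _ =>
          mul_nonneg (mul_nonneg (hBn i) (hBn i')) (abs_nonneg _)

end Interpolation

section Interpolation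

variable {ι : Type*} [Fintype ι] {H : Type*} [NormedAddCommGroup H] [InnerProductSpace ℝ H]

lemma cesaroFamily_inv {N : ℕ} (hN : 0 < N) (v : ι → ℝ) (e : ℕ → ι → H) {τ : ℝ} (hτ : 0 < τ) :
    cesaroFamily N v e τ ((τ⁻¹ : ℝ) : ℂ) = ((‖∑ i, v i • e 0 i‖ ^ 2 : ℝ) : ℂ) := by
  have h1 : -((τ⁻¹ : ℝ) : ℂ) * τ = -1 := by
    rw [neg_mul, ← Complex.ofReal_mul, inv_mul_cancel₀ hτ.ne', Complex.ofReal_one]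
  rw [cesaroFamily, Finset.sum_eq_single_of_mem 0 (Finset.mem_range.mpr hN)
    fun j _ hj => by rw [h1, cesaroCoef_neg_one, if_neg hj, zero_mul]]
  simp only [analyticCoef_self (inv_nonneg.mpr hτ.le), h1, cesaroCoef_neg_one, if_true, sub_self]
  rw [← real_inner_self_eq_norm_sq]
  simp_rw [sum_inner, inner_sum, real_inner_smul_left, real_inner_smul_right, Complex.ofReal_sum]
  simp [mul_assoc]

lemma norm_cesaroFamily_le_of_re_eq_zero {N : ℕ} {v m : ι → ℝ} (hv : ∀ i, v i ≠ 0)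
    {e : ℕ → ι → H} {τ : ℝ} (hτ : 1 ≤ τ)
    (hbessel : ∀ c : ι → ℝ, ∑ j ∈ Finset.range N, ‖∑ i, c i • e j i‖ ^ 2 ≤ ∑ i, m i * c i ^ 2)
    {ζ : ℂ} (hζ : ζ.re = 0) :
    ‖cesaroFamily N v e τ ζ‖ ≤
      Real.exp (τ ^ 2 + 1) * ∑ i, m i * |v i| ^ (2 / (1 + τ⁻¹)) := by
  set φ := analyticCoef v τ⁻¹ ζ
  have hz : -ζ * τ = ((-ζ.im * τ : ℝ) : ℂ) * Complex.I := by
    conv_lhs => rw [← Complex.re_add_im ζ, hζ]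
    push_cast; ring
  have hsum : ∑ j ∈ Finset.range N, (‖∑ i, (φ i).re • e j i‖ ^ 2 + ‖∑ i, (φ i).im • e j i‖ ^ 2) ≤
      ∑ i, m i * |v i| ^ (2 / (1 + τ⁻¹)) := by
    rw [Finset.sum_add_distrib]
    refine (add_le_add (hbessel _) (hbessel _)).trans_eq ?_
    rw [← Finset.sum_add_distrib]
    refine Finset.sum_congr rfl fun i _ => ?_
    have : (φ i).re ^ 2 + (φ i).im ^ 2 = |v i| ^ (2 / (1 + τ⁻¹)) := by
      rw [sq, sq, ← Complex.normSq_apply, Complex.normSq_eq_norm_sq, norm_analyticCoef hv, hζ,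
        ← Real.rpow_natCast, ← Real.rpow_mul (abs_nonneg _)]
      congr 1; push_cast; ring
    rw [← this]; ring
  rw [cesaroFamily, norm_mul]
  calc _ ≤ (Real.exp (τ ^ 2 + 1) * Real.exp (-((τ ^ 2 + 1) * ζ.im ^ 2))) *
        ∑ j ∈ Finset.range N, Real.exp ((-ζ.im * τ) ^ 2) *
          (‖∑ i, (φ i).re • e j i‖ ^ 2 + ‖∑ i, (φ i).im • e j i‖ ^ 2) := by
        gcongr
        · exact norm_exp_mul_sub_sq_le hτ hζ.ge (by rw [hζ]; norm_num)
        · refine norm_sum_le_of_le _ fun j _ => ?_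
          rw [norm_mul, hz]
          gcongr
          · exact norm_cesaroCoef_mul_I_le _ _
          · exact norm_sum_mul_inner_le _ _
    _ = Real.exp (τ ^ 2 + 1) * (Real.exp (-((τ ^ 2 + 1) * ζ.im ^ 2) + (-ζ.im * τ) ^ 2) *
        ∑ j ∈ Finset.range N,
          (‖∑ i, (φ i).re • e j i‖ ^ 2 + ‖∑ i, (φ i).im • e j i‖ ^ 2)) := by
        rw [← Finset.mul_sum, Real.exp_add (-((τ ^ 2 + 1) * ζ.im ^ 2))]; ring
    _ ≤ Real.exp (τ ^ 2 + 1) * (1 * ∑ i, m i * |v i| ^ (2 / (1 + τ⁻¹))) := by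
        gcongr
        rw [Real.exp_le_one_iff]
        nlinarith [sq_nonneg ζ.im]
    _ = _ := by rw [one_mul]

lemma norm_cesaroFamily_le_of_re_eq_one {N : ℕ} {v m : ι → ℝ} (hv : ∀ i, v i ≠ 0)
    {e : ℕ → ι → H} {τ K : ℝ} (hτ : 1 ≤ τ) (hK : 0 ≤ K)
    (hker : ∀ z : ℂ, z.re = -τ → ∀ i i', ‖∑ j ∈ Finset.range N,
      cesaroCoef z j * ((inner ℝ (e j i) (e j i') : ℝ) : ℂ)‖ ≤
        K * Real.exp (Real.pi * |z.im|) * (m i * m i'))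
    {ζ : ℂ} (hζ : ζ.re = 1) :
    ‖cesaroFamily N v e τ ζ‖ ≤
      Real.exp (τ ^ 2 + 1) * (Real.exp (Real.pi ^ 2) * K) *
        (∑ i, m i * |v i| ^ (2 / (1 + τ⁻¹))) ^ 2 := by
  set φ := analyticCoef v τ⁻¹ ζ
  have hφ : ∀ i, ‖φ i‖ = |v i| ^ (2 / (1 + τ⁻¹)) := fun i => by
    rw [norm_analyticCoef hv, hζ, one_add_one_eq_two]
  have hzre : (-ζ * τ).re = -τ := by simp [hζ]
  have hzim : |(-ζ * τ).im| = |ζ.im| * τ := by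
    rw [Complex.im_mul_ofReal, abs_mul, Complex.neg_im, abs_neg,
      abs_of_nonneg (by linarith : 0 ≤ τ)]
  have hswap : ∑ j ∈ Finset.range N, cesaroCoef (-ζ * τ) j *
      ∑ i, ∑ i', φ i * φ i' * ((inner ℝ (e j i) (e j i') : ℝ) : ℂ) =
      ∑ i, ∑ i', φ i * φ i' * ∑ j ∈ Finset.range N,
        cesaroCoef (-ζ * τ) j * ((inner ℝ (e j i) (e j i') : ℝ) : ℂ) := by
    simp_rw [Finset.mul_sum]
    rw [Finset.sum_comm]
    refine Finset.sum_congr rfl fun i _ => ?_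
    rw [Finset.sum_comm]
    refine Finset.sum_congr rfl fun i' _ => Finset.sum_congr rfl fun j _ => by ring
  rw [cesaroFamily, hswap, norm_mul]
  calc _ ≤ (Real.exp (τ ^ 2 + 1) * Real.exp (-((τ ^ 2 + 1) * ζ.im ^ 2))) *
        ∑ i, ∑ i', |v i| ^ (2 / (1 + τ⁻¹)) * |v i'| ^ (2 / (1 + τ⁻¹)) *
          (K * Real.exp (Real.pi * (|ζ.im| * τ)) * (m i * m i')) := by
        gcongr
        · exact norm_exp_mul_sub_sq_le hτ (by rw [hζ]; norm_num) hζ.le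
        · refine norm_sum_le_of_le _ fun i _ => norm_sum_le_of_le _ fun i' _ => ?_
          rw [norm_mul, norm_mul, hφ, hφ, ← hzim]
          gcongr
          exact hker _ hzre i i'
    _ = Real.exp (τ ^ 2 + 1) * (Real.exp (-((τ ^ 2 + 1) * ζ.im ^ 2) + Real.pi * (|ζ.im| * τ)) * K) *
        (∑ i, m i * |v i| ^ (2 / (1 + τ⁻¹))) ^ 2 := by
        rw [sq (∑ i, _), Finset.sum_mul_sum, Real.exp_add (-((τ ^ 2 + 1) * ζ.im ^ 2))]
        simp_rw [Finset.mul_sum]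
        exact Finset.sum_congr rfl fun i _ => Finset.sum_congr rfl fun i' _ => by ring
    _ ≤ _ := by
        gcongr
        rw [← sq_abs ζ.im]
        nlinarith [sq_nonneg (|ζ.im| * τ - Real.pi), sq_nonneg |ζ.im|, sq_nonneg (|ζ.im| * τ)]

lemma norm_sum_smul_sq_le_of_cesaro {N : ℕ} (hN : 0 < N) {v m : ι → ℝ} (hv : ∀ i, v i ≠ 0)
    (hm : ∀ i, 0 ≤ m i) {e : ℕ → ι → H} {τ K : ℝ} (hτ : 1 ≤ τ) (hK : 0 ≤ K)
    (hbessel : ∀ c : ι → ℝ, ∑ j ∈ Finset.range N, ‖∑ i, c i • e j i‖ ^ 2 ≤ ∑ i, m i * c i ^ 2)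
    (hker : ∀ z : ℂ, z.re = -τ → ∀ i i', ‖∑ j ∈ Finset.range N,
      cesaroCoef z j * ((inner ℝ (e j i) (e j i') : ℝ) : ℂ)‖ ≤
        K * Real.exp (Real.pi * |z.im|) * (m i * m i')) :
    ‖∑ i, v i • e 0 i‖ ^ 2 ≤ Real.exp (τ ^ 2 + 1) * (Real.exp (Real.pi ^ 2) * K) ^ τ⁻¹ *
      (∑ i, m i * |v i| ^ (2 / (1 + τ⁻¹))) ^ (1 + τ⁻¹) := by
  set S := ∑ i, m i * |v i| ^ (2 / (1 + τ⁻¹))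
  have hS : 0 ≤ S := Finset.sum_nonneg fun i _ => mul_nonneg (hm i) (by positivity)
  have hτ0 : 0 ≤ τ⁻¹ := by positivity
  have hτ1 : τ⁻¹ ≤ 1 := inv_le_one_of_one_le₀ hτ
  have h := Complex.HadamardThreeLines.norm_le_interp_of_mem_verticalClosedStrip₀₁'
    (cesaroFamily N v e τ) (z := ((τ⁻¹ : ℝ) : ℂ)) ⟨hτ0, hτ1⟩
    (differentiable_cesaroFamily N hv e τ).diffContOnCl (bddAbove_norm_cesaroFamily N hv e hτ)
    (fun ζ hζ => norm_cesaroFamily_le_of_re_eq_zero hv hτ hbessel hζ)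
    (fun ζ hζ => norm_cesaroFamily_le_of_re_eq_one hv hτ hK hker hζ)
  rw [cesaroFamily_inv hN v e (by linarith), Complex.norm_real,
    Real.norm_of_nonneg (by positivity), Complex.ofReal_re] at h
  refine h.trans_eq ?_
  rw [Real.mul_rpow (Real.exp_pos _).le hS, Real.mul_rpow (by positivity) (by positivity),
    Real.mul_rpow (Real.exp_pos _).le (by positivity), ← Real.rpow_natCast S, ← Real.rpow_mul hS]
  have e1 : Real.exp (τ ^ 2 + 1) ^ (1 - τ⁻¹) * Real.exp (τ ^ 2 + 1) ^ τ⁻¹ =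
      Real.exp (τ ^ 2 + 1) := by
    rw [← Real.rpow_add (Real.exp_pos _)]; simp
  have e2 : S ^ (1 - τ⁻¹) * S ^ (((2 : ℕ) : ℝ) * τ⁻¹) = S ^ (1 + τ⁻¹) := by
    rw [← Real.rpow_add_of_nonneg hS (by linarith) (by positivity)]
    congr 1; push_cast; ring
  rw [← e2]
  nth_rewrite 3 [← e1]
  ring

end Interpolation

lemma inner_indL2 {d : ℕ} {A B : Set (Sph d)} (hA : MeasurableSet A) (hB : MeasurableSet B) :
    @inner ℝ _ _ (indL2 hA) (indL2 hB) = (sphMeasure d).real (A ∩ B) := by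
  rw [indL2, L2.inner_indicatorConstLp_one]
  have : ∫ x in A, (indL2 hB : Sph d → ℝ) x ∂sphMeasure d =
      ∫ x in A, B.indicator (fun _ => (1 : ℝ)) x ∂sphMeasure d := by
    refine integral_congr_ae (ae_restrict_of_ae ?_)
    exact indicatorConstLp_coeFn
  rw [this, setIntegral_indicator hB]
  simp

lemma norm_sum_smul_indL2_sq {d : ℕ} {ι : Type*} [Fintype ι] {A : ι → Set (Sph d)}
    (hA : ∀ i, MeasurableSet (A i)) (hdisj : Pairwise fun i i' => Disjoint (A i) (A i'))
    (c : ι → ℝ) :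
    ‖∑ i, c i • indL2 (hA i)‖ ^ 2 = ∑ i, (sphMeasure d).real (A i) * c i ^ 2 := by
  rw [← real_inner_self_eq_norm_sq, sum_inner]
  refine Finset.sum_congr rfl fun i hi => ?_
  rw [inner_sum, Finset.sum_eq_single_of_mem i hi]
  · rw [real_inner_smul_left, real_inner_smul_right, inner_indL2, Set.inter_self]
    ring
  · intro i' _ h
    rw [real_inner_smul_left, real_inner_smul_right, inner_indL2, (hdisj h.symm).inter_eq]
    simp

lemma norm_sum_mul_integral_zonalKernel_le {d : ℕ} {N : ℕ} {c : ℕ → ℂ} {k : ℕ → ℕ} {B : ℝ}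
    (hB : ∀ t ∈ Set.Icc (-1 : ℝ) 1, ‖∑ j ∈ Finset.range N, c j * (zonalFn d (k j) t : ℂ)‖ ≤ B)
    (A A' : Set (Sph d)) :
    ‖∑ j ∈ Finset.range N, c j *
      ((∫ y in A, ∫ x in A', zonalKernel (k j) x y ∂sphMeasure d ∂sphMeasure d : ℝ) : ℂ)‖ ≤
        B * ((sphMeasure d).real A * (sphMeasure d).real A') := by
  set P := ((sphMeasure d).restrict A).prod ((sphMeasure d).restrict A')
  have hint : ∀ j, Integrable (fun q : Sph d × Sph d => zonalKernel (k j) q.2 q.1) P := fun j =>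
    ((continuous_zonalKernel d (k j)).comp continuous_swap).integrable_of_hasCompactSupport
      (HasCompactSupport.of_compactSpace _)
  have heq : ∑ j ∈ Finset.range N, c j *
      ((∫ y in A, ∫ x in A', zonalKernel (k j) x y ∂sphMeasure d ∂sphMeasure d : ℝ) : ℂ) =
      ∫ q, ∑ j ∈ Finset.range N, c j * (zonalKernel (k j) q.2 q.1 : ℂ) ∂P := by
    rw [integral_finsetSum _ fun j _ => ((hint j).ofReal).const_mul _]
    refine Finset.sum_congr rfl fun j _ => ?_
    rw [integral_const_mul, integral_complex_ofReal, integral_prod _ (hint j)]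
  rw [heq]
  refine (norm_integral_le_of_norm_le_const (C := B)
    (Filter.Eventually.of_forall fun q => ?_)).trans_eq ?_
  · refine hB _ (abs_le.mp ?_)
    refine (abs_real_inner_le_norm _ _).trans_eq ?_
    simp
  · rw [← Set.univ_prod_univ, measureReal_prod_prod]
    simp

lemma exists_norm_proj_sum_indL2_sq_le {d : ℕ} (hd : 3 ≤ d)
    {proj : ℕ → Lp ℝ 2 (sphMeasure d) → Lp ℝ 2 (sphMeasure d)}
    (hproj : ∀ k, IsOrthProjOnto d k (proj k)) {τ : ℝ} (hτ : (d : ℝ) / 2 ≤ τ) :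
    ∃ C : ℝ, 0 < C ∧ ∀ n : ℕ, 1 ≤ n → ∀ (ι : Type) [Fintype ι] (A : ι → Set (Sph d))
      (hA : ∀ i, MeasurableSet (A i)) (v : ι → ℝ),
      (Pairwise fun i i' => Disjoint (A i) (A i')) → (∀ i, v i ≠ 0) →
      ‖proj n (∑ i, v i • indL2 (hA i))‖ ^ 2 ≤ C * (n : ℝ) ^ (((d : ℝ) - 2) / 2 * τ⁻¹) *
        (∑ i, (sphMeasure d).real (A i) * |v i| ^ (2 / (1 + τ⁻¹))) ^ (1 + τ⁻¹) := by
  obtain ⟨C, hC, hker⟩ := exists_norm_sum_cesaroCoef_mul_zonalFn_le hd hτ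
  have hτ1 : 1 ≤ τ := by
    have : (3 : ℝ) ≤ d := by exact_mod_cast hd
    linarith
  refine ⟨Real.exp (τ ^ 2 + 1) * (Real.exp (Real.pi ^ 2) * C) ^ τ⁻¹, by positivity,
    fun n hn ι _ A hA v hdisj hv => ?_⟩
  have h := norm_sum_smul_sq_le_of_cesaro (N := n / 2 + 1) (by omega) hv
    (m := fun i => (sphMeasure d).real (A i)) (fun i => measureReal_nonneg)
    (e := fun j i => proj (n - 2 * j) (indL2 (hA i))) hτ1
    (K := C * (n : ℝ) ^ (((d : ℝ) - 2) / 2)) (by positivity) ?_ ?_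
  · rw [(hproj n).map_sum_smul]
    refine h.trans_eq ?_
    rw [← mul_assoc (Real.exp (Real.pi ^ 2)), Real.mul_rpow (by positivity) (by positivity),
      ← Real.rpow_mul (by positivity)]
    ring
  · intro c
    simp_rw [← (hproj _).map_sum_smul]
    rw [← norm_sum_smul_indL2_sq hA hdisj]
    exact sum_norm_proj_sq_le (by omega) hproj n _
  · intro z hz i i'
    simp_rw [(hproj _).inner_map_indL2 (by omega : 0 < d)]
    refine norm_sum_mul_integral_zonalKernel_le (fun t ht => ?_) _ _
    refine (hker n hn z hz t ht).trans_eq ?_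
    ring

section Density

variable {d k : ℕ} {T : Lp ℝ 2 (sphMeasure d) → Lp ℝ 2 (sphMeasure d)}

lemma IsOrthProjOnto.norm_map_le (hT : IsOrthProjOnto d k T) (f : Lp ℝ 2 (sphMeasure d)) :
    ‖T f‖ ≤ ‖f‖ := by
  have h := real_inner_le_norm f (T f)
  rw [← hT.inner_map_map, real_inner_self_eq_norm_sq, sq] at h
  by_contra! hlt
  have : 0 < ‖T f‖ := (norm_nonneg f).trans_lt hlt
  nlinarith

lemma IsOrthProjOnto.map_sub (hT : IsOrthProjOnto d k T) (f g : Lp ℝ 2 (sphMeasure d)) :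
    T (f - g) = T f - T g := by
  refine hT.eq_of_mem (Submodule.sub_mem _ (hT f).1 (hT g).1) fun u hu => ?_
  rw [sub_sub_sub_comm, inner_sub_left, (hT f).2 u hu, (hT g).2 u hu, sub_zero]

lemma IsOrthProjOnto.continuous (hT : IsOrthProjOnto d k T) : Continuous T := by
  refine (LipschitzWith.of_dist_le_mul (K := 1) fun f g => ?_).continuous
  rw [dist_eq_norm, dist_eq_norm, ← hT.map_sub, NNReal.coe_one, one_mul]
  exact hT.norm_map_le _

end Density

lemma continuous_toReal_eLpNorm {α : Type*} [MeasurableSpace α] {μ : Measure α}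
    [IsFiniteMeasure μ] {p q : ℝ≥0∞} [Fact (1 ≤ q)] (hp : 1 ≤ p) (hpq : p ≤ q) :
    Continuous fun f : Lp ℝ q μ => (eLpNorm f p μ).toReal := by
  set c := μ Set.univ ^ (1 / p.toReal - 1 / q.toReal)
  have hc : c ≠ ∞ := by
    refine ENNReal.rpow_ne_top_of_nonneg ?_ (measure_ne_top _ _)
    rcases eq_or_ne q ∞ with rfl | hq
    · simp
    · have hp0 : 0 < p.toReal := ENNReal.toReal_pos (by positivity) (ne_top_of_le_ne_top hq hpq)
      have := ENNReal.toReal_mono hq hpq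
      exact sub_nonneg.mpr (by gcongr)
  refine (LipschitzWith.of_le_add_mul c.toNNReal fun f g => ?_).continuous
  have hmem : ∀ f : Lp ℝ q μ, MemLp f p μ := fun f => (Lp.memLp f).mono_exponent hpq
  have h1 : eLpNorm f p μ ≤ eLpNorm g p μ + eLpNorm (f - g : Lp ℝ q μ) p μ := by
    have : (f : α → ℝ) =ᵐ[μ] g + (f - g : Lp ℝ q μ) := by
      filter_upwards [Lp.coeFn_sub f g] with x hx
      rw [Pi.add_apply, hx, Pi.sub_apply]
      ring
    rw [eLpNorm_congr_ae this]
    exact eLpNorm_add_le (hmem g).1 (hmem _).1 hp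
  have h2 : eLpNorm (f - g : Lp ℝ q μ) p μ ≤ eLpNorm (f - g : Lp ℝ q μ) q μ * c :=
    eLpNorm_le_eLpNorm_mul_rpow_measure_univ hpq (Lp.memLp _).1
  rw [dist_eq_norm, Lp.norm_def, mul_comm]
  rw [show ((c.toNNReal : NNReal) : ℝ) = c.toReal from rfl, ← ENNReal.toReal_mul,
    ← ENNReal.toReal_add (hmem g).2.ne (ENNReal.mul_ne_top (Lp.eLpNorm_ne_top _) hc)]
  exact ENNReal.toReal_mono (ENNReal.add_ne_top.mpr
    ⟨(hmem g).2.ne, ENNReal.mul_ne_top (Lp.eLpNorm_ne_top _) hc⟩) (h1.trans (by gcongr))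

lemma simpleFunc_eq_sum_indL2 {d : ℕ} (g : Lp ℝ 2 (sphMeasure d)) (h : SimpleFunc (Sph d) ℝ)
    (hgh : g =ᵐ[sphMeasure d] h) :
    g = ∑ y : {y // y ∈ h.range.filter (· ≠ 0)}, (y : ℝ) • indL2 (h.measurableSet_fiber y) := by
  have hind : ∀ y : ℝ, ((y • indL2 (h.measurableSet_fiber y) : Lp ℝ 2 (sphMeasure d)) :
      Sph d → ℝ) =ᵐ[sphMeasure d] (h ⁻¹' {y}).indicator fun _ => y := fun y => by
    filter_upwards [Lp.coeFn_smul y (indL2 (h.measurableSet_fiber y)),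
      indicatorConstLp_coeFn (p := 2) (hs := h.measurableSet_fiber y)
        (hμs := measure_ne_top (sphMeasure d) _) (c := (1 : ℝ))] with x hx hx'
    rw [hx, Pi.smul_apply, indL2, hx']
    by_cases hxy : x ∈ h ⁻¹' {y} <;> simp [hxy]
  apply Lp.ext
  refine hgh.trans (Filter.EventuallyEq.symm ?_)
  refine (Lp.coeFn_fun_finsetSum _ _).trans ?_
  filter_upwards [(h.range.filter (· ≠ 0)).eventually_all.mpr fun y _ => hind y] with x hx
  refine (Finset.sum_congr rfl
    fun (y : {y // y ∈ h.range.filter (· ≠ 0)}) _ => hx y.1 y.2).trans ?_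
  rw [Finset.sum_coe_sort (h.range.filter (· ≠ 0)) fun y => (h ⁻¹' {y}).indicator (fun _ => y) x]
  by_cases h0 : h x = 0
  · rw [h0]
    refine Finset.sum_eq_zero fun y hy => ?_
    exact Set.indicator_of_notMem (by
      simpa [h0] using (Finset.mem_filter.mp hy).2.symm) _
  · rw [Finset.sum_eq_single_of_mem (h x) (Finset.mem_filter.mpr ⟨h.mem_range_self x, h0⟩)]
    · simp
    · intro y _ hy
      exact Set.indicator_of_notMem (by simpa using hy.symm) _

lemma toReal_eLpNorm_simpleFunc {α : Type*} [MeasurableSpace α] {μ : Measure α}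
    [IsFiniteMeasure μ] (h : SimpleFunc α ℝ) {p : ℝ} (hp : 0 < p) :
    (eLpNorm h (ENNReal.ofReal p) μ).toReal =
      (∑ y : {y // y ∈ h.range.filter (· ≠ 0)}, μ.real (h ⁻¹' {(y : ℝ)}) * |(y : ℝ)| ^ p) ^
        (1 / p) := by
  rw [eLpNorm_eq_eLpNorm' (by simpa) ENNReal.ofReal_ne_top, ENNReal.toReal_ofReal hp.le,
    h.eLpNorm'_eq, ← ENNReal.toReal_rpow, ENNReal.toReal_sum fun y _ => ENNReal.mul_ne_top
      (ENNReal.rpow_ne_top_of_nonneg hp.le enorm_ne_top) (measure_ne_top _ _),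
    Finset.sum_coe_sort (h.range.filter (· ≠ 0)) fun y => μ.real (h ⁻¹' {y}) * |y| ^ p,
    Finset.sum_filter]
  congr 1
  refine Finset.sum_congr rfl fun y _ => ?_
  rw [ENNReal.toReal_mul, ← ENNReal.toReal_rpow, mul_comm, toReal_enorm, Real.norm_eq_abs]
  split_ifs with hy
  · rfl
  · rw [not_not.mp hy]
    simp [hp.ne']

lemma exists_norm_proj_sq_le {d : ℕ} (hd : 3 ≤ d)
    {proj : ℕ → Lp ℝ 2 (sphMeasure d) → Lp ℝ 2 (sphMeasure d)}
    (hproj : ∀ k, IsOrthProjOnto d k (proj k)) {p : ℝ} (hp1 : 2 * d / (d + 2) ≤ p) (hp2 : p < 2) :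
    ∃ C : ℝ, 0 < C ∧ ∀ n : ℕ, 1 ≤ n → ∀ f : Lp ℝ 2 (sphMeasure d),
      ‖proj n f‖ ^ 2 ≤ C * (n : ℝ) ^ (((d : ℝ) - 2) / 2 * (2 / p - 1)) *
        (eLpNorm f (ENNReal.ofReal p) (sphMeasure d)).toReal ^ 2 := by
  have hd' : (3 : ℝ) ≤ d := by exact_mod_cast hd
  have hp : 1 ≤ p := by
    refine le_trans ?_ hp1
    rw [one_le_div (by positivity)]; linarith
  have hp0 : 0 < p := by linarith
  have ht0 : 0 < 2 / p - 1 := by rw [sub_pos, one_lt_div hp0]; exact hp2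
  have hτ : (d : ℝ) / 2 ≤ (2 / p - 1)⁻¹ := by
    rw [le_inv_comm₀ (by positivity) ht0, inv_div, sub_le_iff_le_add, div_le_iff₀ hp0]
    rw [div_le_iff₀ (by positivity)] at hp1
    have : (2 / (d : ℝ) + 1) * p = p * (d + 2) / d := by field_simp; ring
    rw [this, le_div_iff₀ (by positivity)]
    exact hp1
  obtain ⟨C, hC, hbound⟩ := exists_norm_proj_sum_indL2_sq_le hd hproj hτ
  refine ⟨C, hC, fun n hn f => ?_⟩
  refine (Lp.simpleFunc.denseRange (E := ℝ) (μ := sphMeasure d) (p := 2) (by norm_num)).induction_on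
    (p := fun f : Lp ℝ 2 (sphMeasure d) => ‖proj n f‖ ^ 2 ≤
      C * (n : ℝ) ^ (((d : ℝ) - 2) / 2 * (2 / p - 1)) *
        (eLpNorm f (ENNReal.ofReal p) (sphMeasure d)).toReal ^ 2) f ?_ fun g => ?_
  · refine isClosed_le ((hproj n).continuous.norm.pow 2)
      (((continuous_toReal_eLpNorm ?_ ?_).pow 2).const_mul _)
    · simpa using hp
    · rw [← ENNReal.ofReal_ofNat]; exact ENNReal.ofReal_le_ofReal hp2.le
  · set h := Lp.simpleFunc.toSimpleFunc g
    have hgh : ((g : Lp ℝ 2 (sphMeasure d)) : Sph d → ℝ) =ᵐ[sphMeasure d] h :=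
      (Lp.simpleFunc.toSimpleFunc_eq_toFun g).symm
    rw [eLpNorm_congr_ae hgh, toReal_eLpNorm_simpleFunc h hp0, simpleFunc_eq_sum_indL2 _ h hgh]
    have := hbound n hn {y // y ∈ h.range.filter (· ≠ 0)} (fun y => h ⁻¹' {(y : ℝ)})
      (fun y => h.measurableSet_fiber y) (fun y => y)
      (fun y y' hy => Disjoint.preimage _ (by simpa using fun hh => hy (Subtype.ext hh)))
      (fun y => (Finset.mem_filter.mp y.2).2)
    rw [inv_inv, add_sub_cancel, div_div_cancel₀ two_ne_zero] at this
    refine this.trans_eq ?_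
    rw [← Real.rpow_mul_natCast (Finset.sum_nonneg fun y _ => by positivity)]
    congr 2
    push_cast; ring

lemma toReal_critical_exponent {d : ℕ} (hd : 3 ≤ d) :
    (1 + (((d : ℝ≥0∞) - 2) / 2) / ((((d : ℝ≥0∞) - 2) / 2) + 2)).toReal = 2 * d / (d + 2) := by
  have hd' : (2 : ℝ≥0∞) ≤ d := by exact_mod_cast (by omega : 2 ≤ d)
  have hd0 : (0 : ℝ) < (d : ℝ) + 2 := by positivity
  have hfin : ((d : ℝ≥0∞) - 2) / 2 ≠ ∞ :=
    ENNReal.div_ne_top (ENNReal.sub_ne_top (ENNReal.natCast_ne_top d)) two_ne_zero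
  have hsub : (((d : ℝ≥0∞) - 2) / 2).toReal = ((d : ℝ) - 2) / 2 := by
    rw [ENNReal.toReal_div, ENNReal.toReal_sub_of_le hd' (ENNReal.natCast_ne_top d)]
    simp
  have hden : ((d : ℝ≥0∞) - 2) / 2 + 2 ≠ 0 := by simp
  rw [ENNReal.toReal_add ENNReal.one_ne_top (ENNReal.div_ne_top hfin hden), ENNReal.toReal_div,
    ENNReal.toReal_add hfin ENNReal.ofNat_ne_top, hsub, ENNReal.toReal_one, ENNReal.toReal_ofNat]
  have : ((d : ℝ) - 2) / 2 + 2 = (d + 2) / 2 := by ring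
  rw [this]
  field_simp
  ring

/-- Lemma 2.1(ii) (Sogge): if `p_λ := 1 + λ/(λ+2) ≤ p ≤ 2` with `λ = (d-2)/2`, then
`‖proj_n f‖_2 ≤ C n^{λ(1/p - 1/2)} ‖f‖_p` for all `f ∈ L²(S^{d-1}, σ)`. -/
theorem proj_bound_ii
    (d : ℕ) (hd : 3 ≤ d) (p : ℝ≥0∞)
    (hp1 : 1 + (((d : ℝ≥0∞) - 2) / 2) / ((((d : ℝ≥0∞) - 2) / 2) + 2) ≤ p)
    (hp2 : p ≤ 2)
    (proj : ℕ → Lp ℝ 2 (sphMeasure d) → Lp ℝ 2 (sphMeasure d))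
    (hproj : ∀ k, IsOrthProjOnto d k (proj k)) :
    ∃ C : ℝ, 0 < C ∧ ∀ n : ℕ, 1 ≤ n → ∀ f : Lp ℝ 2 (sphMeasure d),
      eLpNorm (⇑(proj n f)) 2 (sphMeasure d) ≤
        ENNReal.ofReal
            (C * (n : ℝ) ^ ((((d : ℝ) - 2) / 2) * (1 / p.toReal - 1 / 2))) *
          eLpNorm (⇑f) p (sphMeasure d) := by
  have hnorm : ∀ f : Lp ℝ 2 (sphMeasure d), eLpNorm f 2 (sphMeasure d) = ENNReal.ofReal ‖f‖ :=
    fun f => by rw [Lp.norm_def, ENNReal.ofReal_toReal (Lp.eLpNorm_ne_top f)]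
  rcases hp2.eq_or_lt with rfl | hlt
  · refine ⟨1, one_pos, fun n _ f => ?_⟩
    rw [hnorm, hnorm]
    simpa using ENNReal.ofReal_le_ofReal ((hproj n).norm_map_le f)
  have hp : p ≠ ∞ := hlt.ne_top
  have hlo : 2 * (d : ℝ) / (d + 2) ≤ p.toReal :=
    (toReal_critical_exponent hd).symm.le.trans (ENNReal.toReal_mono hp hp1)
  have hhi : p.toReal < 2 := by
    simpa using (ENNReal.toReal_lt_toReal hp ENNReal.ofNat_ne_top).mpr hlt
  obtain ⟨C, hC, hbound⟩ := exists_norm_proj_sq_le hd hproj hlo hhi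
  refine ⟨√C, Real.sqrt_pos.mpr hC, fun n hn f => ?_⟩
  have hb := hbound n hn f
  rw [ENNReal.ofReal_toReal hp] at hb
  have hfin : eLpNorm f p (sphMeasure d) ≠ ∞ := ((Lp.memLp f).mono_exponent hp2).2.ne
  rw [hnorm, ← ENNReal.ofReal_toReal hfin, ← ENNReal.ofReal_mul (by positivity)]
  refine ENNReal.ofReal_le_ofReal (le_of_sq_le_sq (hb.trans_eq ?_) (by positivity))
  rw [mul_pow, mul_pow, Real.sq_sqrt hC.le, ← Real.rpow_mul_natCast (by positivity)]
  congr 3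
  push_cast; ring
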